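/- arXiv:1404.4771 — 2 statements merged into one kernel-verified Lean document; each statement's English description precedes it below -/
import Mathlib

section
/- Let (G, G⁺) be a countable simple dimension group containing a subgroup H that is not cyclic, has rank one (for all a, b ∈ H there exist integers m, n, not both zero, with m·a = n·b), and satisfies H ∩ G⁺ ≠ {0}; let t be a real number with 0 ≤ t < ∞. Then there exist a finite alphabet Λ, a nonperiodic Toeplitz sequence η : ℤ → Λ with associated Toeplitz flow (X, T), and a surjective group homomorphism φ : C(X,ℤ) → G such that the kernel of φ equals the coboundary subgroup B_T and φ maps {f ∈ C(X,ℤ) : f ≥ 0} onto G⁺ (so K⁰(X,T) with its positive cone is order isomorphic to (G, G⁺)), and the topological entropy of T equals t. -/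
/-- A Toeplitz sequence: every position is periodic for some period `p ≥ 1`. -/
def IsToeplitz {Λ : Type*} (η : ℤ → Λ) : Prop :=
  ∀ n : ℤ, ∃ p : ℤ, 1 ≤ p ∧ ∀ m : ℤ, η (n + m * p) = η n

/-- A sequence is nonperiodic if it has no global period `p ≥ 1`. -/
def IsNonperiodic {Λ : Type*} (η : ℤ → Λ) : Prop :=
  ¬ ∃ p : ℤ, 1 ≤ p ∧ ∀ n : ℤ, η (n + p) = η n

/-- The two-sided shift orbit of `η` in `Λ^ℤ`. -/
def shiftOrbit {Λ : Type*} (η : ℤ → Λ) : Set (ℤ → Λ) :=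
  {x | ∃ n : ℤ, x = fun k => η (k + n)}

/-- The shift homeomorphism on `Λ^ℤ`. -/
def shiftHomeo (Λ : Type*) [TopologicalSpace Λ] : (ℤ → Λ) ≃ₜ (ℤ → Λ) where
  toFun x := fun k => x (k + 1)
  invFun x := fun k => x (k - 1)
  left_inv x := by funext k; simp
  right_inv x := by funext k; simp
  continuous_toFun := continuous_pi fun k => continuous_apply (k + 1)
  continuous_invFun := continuous_pi fun k => continuous_apply (k - 1)

/-- The phase space of the Toeplitz flow of `η`: the orbit closure of `η`. -/
def toeplitzX {Λ : Type*} [TopologicalSpace Λ] (η : ℤ → Λ) : Set (ℤ → Λ) :=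
  closure (shiftOrbit η)

lemma shiftHomeo_image_orbit {Λ : Type*} [TopologicalSpace Λ] (η : ℤ → Λ) :
    shiftHomeo Λ '' shiftOrbit η = shiftOrbit η := by
  ext x
  constructor
  · rintro ⟨y, ⟨n, rfl⟩, rfl⟩
    exact ⟨n + 1, by funext k; show η (k + 1 + n) = η (k + (n + 1)); ring_nf⟩
  · rintro ⟨n, rfl⟩
    refine ⟨fun k => η (k + (n - 1)), ⟨n - 1, rfl⟩, ?_⟩
    funext k; show η (k + 1 + (n - 1)) = η (k + n); ring_nf

lemma shiftHomeo_image_toeplitzX {Λ : Type*} [TopologicalSpace Λ] (η : ℤ → Λ) :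
    shiftHomeo Λ '' toeplitzX η = toeplitzX η := by
  rw [toeplitzX, Homeomorph.image_closure, shiftHomeo_image_orbit]

/-- The Toeplitz flow transformation: the shift restricted to the orbit
closure of `η`. -/
def toeplitzT {Λ : Type*} [TopologicalSpace Λ] (η : ℤ → Λ) :
    ↥(toeplitzX η) ≃ₜ ↥(toeplitzX η) :=
  ((shiftHomeo Λ).image (toeplitzX η)).trans
    (Homeomorph.setCongr (shiftHomeo_image_toeplitzX η))

/-- A Toeplitz flow: a nonperiodic Toeplitz sequence over a finite nonempty
alphabet (with the discrete uniformity/topology), together with the orbit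
closure dynamics. -/
structure ToeplitzFlow : Type 1 where
  Λ : Type
  [fin : Fintype Λ]
  [nonempty : Nonempty Λ]
  η : ℤ → Λ
  toeplitz : IsToeplitz η
  nonperiodic : IsNonperiodic η

attribute [instance] ToeplitzFlow.fin ToeplitzFlow.nonempty

noncomputable instance (F : ToeplitzFlow) : UniformSpace F.Λ := ⊥

instance (F : ToeplitzFlow) : DiscreteTopology F.Λ := by
  constructor
  change UniformSpace.toTopologicalSpace = ⊥
  exact UniformSpace.toTopologicalSpace_bot

/-- The phase space of a Toeplitz flow. -/
abbrev ToeplitzFlow.X (F : ToeplitzFlow) : Type := ↥(toeplitzX F.η)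

/-- The transformation of a Toeplitz flow (the restricted shift). -/
noncomputable def ToeplitzFlow.T (F : ToeplitzFlow) : F.X ≃ₜ F.X := toeplitzT F.η

/-- The topological entropy (Bowen–Dinaburg cover entropy, with respect to the
canonical uniformity of the compact metrizable space `F.X`) of a Toeplitz flow. -/
noncomputable def ToeplitzFlow.entropy (F : ToeplitzFlow) : EReal :=
  Dynamics.coverEntropy (F.T : F.X → F.X) Set.univ

/-- `u` is an order unit for the cone `P`. -/
def IsOrderUnitFor {G : Type*} [AddCommGroup G] (P : Set G) (u : G) : Prop :=
  u ∈ P ∧ ∀ a : G, ∃ n : ℤ, 1 ≤ n ∧ n • u - a ∈ P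

/-- `(G, P)` is a (countable, noncyclic) simple dimension group. -/
structure IsSimpleDimensionGroup (G : Type*) [AddCommGroup G] (P : Set G) : Prop where
  countable : Countable G
  zero_mem : (0 : G) ∈ P
  add_mem : ∀ a b : G, a ∈ P → b ∈ P → a + b ∈ P
  pos_neg_eq_zero : ∀ a : G, a ∈ P → -a ∈ P → a = 0
  directed : ∀ g : G, ∃ a ∈ P, ∃ b ∈ P, g = a - b
  unperforated : ∀ (n : ℤ) (a : G), 1 ≤ n → n • a ∈ P → a ∈ P
  riesz : ∀ a₁ a₂ b₁ b₂ : G, b₁ - a₁ ∈ P → b₂ - a₁ ∈ P → b₁ - a₂ ∈ P → b₂ - a₂ ∈ P →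
    ∃ c : G, c - a₁ ∈ P ∧ c - a₂ ∈ P ∧ b₁ - c ∈ P ∧ b₂ - c ∈ P
  simple : ∀ a : G, a ∈ P → a ≠ 0 → IsOrderUnitFor P a
  noncyclic : ¬ ∃ g : G, ∀ x : G, ∃ n : ℤ, x = n • g

/-- The coboundary homomorphism `g ↦ g - g ∘ T⁻¹` on `C(X, ℤ)`. -/
def coboundaryHom {X : Type*} [TopologicalSpace X] (T : X ≃ₜ X) :
    C(X, ℤ) →+ C(X, ℤ) :=
  AddMonoidHom.mk' (fun g => g - g.comp (T.symm : C(X, X))) (by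
    intro a b
    ext x
    simp [ContinuousMap.add_apply]
    ring)

/-- The subgroup `B_T = {g - g ∘ T⁻¹ : g ∈ C(X, ℤ)}` of coboundaries. -/
def coboundaries {X : Type*} [TopologicalSpace X] (T : X ≃ₜ X) :
    AddSubgroup C(X, ℤ) :=
  (coboundaryHom T).range

section DimensionGroup

open Finset

/-- `a` is expressed through `b` by the matrix `B` of nonnegative integers. -/
def IsRefinement {ι κ G : Type} [Fintype κ] [AddCommMonoid G]
    (a : ι → G) (b : κ → G) (B : κ → ι → ℕ) : Prop :=
  ∀ i, a i = ∑ k, B k i • b k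

/-- Riesz decomposition together with unperforation. -/
structure IsDimensionOrder (G : Type) [AddCommGroup G] [PartialOrder G] : Prop where
  decomp : ∀ a b c : G, 0 ≤ a → 0 ≤ b → 0 ≤ c → a ≤ b + c →
    ∃ b' c', 0 ≤ b' ∧ b' ≤ b ∧ 0 ≤ c' ∧ c' ≤ c ∧ a = b' + c'
  unperforated : ∀ (n : ℕ) (a : G), 0 < n → 0 ≤ n • a → 0 ≤ a

lemma IsRefinement.trans {ι κ μ G : Type} [Fintype κ] [Fintype μ] [AddCommMonoid G]
    {a : ι → G} {b : κ → G} {c : μ → G} {B : κ → ι → ℕ} {C : μ → κ → ℕ}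
    (hB : IsRefinement a b B) (hC : IsRefinement b c C) :
    IsRefinement a c (fun r i => ∑ k, C r k * B k i) := by
  intro i
  rw [hB i]
  simp_rw [Finset.sum_smul]
  rw [Finset.sum_comm]
  refine Finset.sum_congr rfl fun k _ => ?_
  rw [hC k, Finset.smul_sum]
  refine Finset.sum_congr rfl fun r _ => ?_
  rw [smul_smul, mul_comm]

lemma IsRefinement.sum_zsmul {ι κ G : Type} [Fintype ι] [Fintype κ] [AddCommGroup G]
    {a : ι → G} {b : κ → G} {B : κ → ι → ℕ} (hB : IsRefinement a b B) (x : ι → ℤ) :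
    ∑ i, x i • a i = ∑ k, (∑ i, (B k i : ℤ) * x i) • b k := by
  simp_rw [Finset.sum_smul]
  rw [Finset.sum_comm]
  refine Finset.sum_congr rfl fun i _ => ?_
  rw [hB i, Finset.smul_sum]
  refine Finset.sum_congr rfl fun k _ => ?_
  rw [mul_comm, mul_smul, natCast_zsmul]

variable {G : Type} [AddCommGroup G] [PartialOrder G] [IsOrderedAddMonoid G]

lemma IsDimensionOrder.decomp_sum (hG : IsDimensionOrder G) {ι : Type} (s : Finset ι)
    (b : ι → G) (hb : ∀ i ∈ s, 0 ≤ b i) (a : G) (ha : 0 ≤ a) (hab : a ≤ ∑ i ∈ s, b i) :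
    ∃ c : ι → G, (∀ i ∈ s, 0 ≤ c i ∧ c i ≤ b i) ∧ a = ∑ i ∈ s, c i := by
  classical
  induction s using Finset.induction_on generalizing a with
  | empty => exact ⟨fun _ => 0, by simp, by simpa using le_antisymm (by simpa using hab) ha⟩
  | insert j s hj ih =>
    rw [Finset.sum_insert hj] at hab
    have hb' : ∀ i ∈ s, 0 ≤ b i := fun i hi => hb i (Finset.mem_insert_of_mem hi)
    obtain ⟨p, r, hp0, hp, hr0, hr, rfl⟩ := hG.decomp a (b j) _ ha
      (hb j (Finset.mem_insert_self _ _)) (Finset.sum_nonneg hb') hab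
    obtain ⟨c, hc, hs⟩ := ih hb' r hr0 hr
    refine ⟨fun i => if i = j then p else c i, ?_, ?_⟩
    · intro i hi
      by_cases h : i = j
      · subst h; simpa using ⟨hp0, hp⟩
      · simpa [h] using hc i ((Finset.mem_insert.1 hi).resolve_left h)
    · rw [Finset.sum_insert hj, hs]
      simp only [if_true]
      congr 1
      refine Finset.sum_congr rfl fun i hi => ?_
      have : i ≠ j := fun h => hj (h ▸ hi)
      simp [this]

lemma IsDimensionOrder.exists_kill_step (hG : IsDimensionOrder G) {ι : Type} [Fintype ι]
    [DecidableEq ι] (M : ℕ) (a : ι → G) (ha : ∀ i, 0 ≤ a i) (x : ι → ℤ)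
    (hx : ∑ i, x i • a i = 0) (hM : ∀ i, |x i| ≤ M) (p : ι) (hp : x p = M) (hM0 : 0 < M) :
    ∃ (b : ι ⊕ ι → G) (C : ι ⊕ ι → ι → ℕ), (∀ k, 0 ≤ b k) ∧ IsRefinement a b C ∧
      (∀ k, |∑ i, (C k i : ℤ) * x i| ≤ M) ∧
      #{k | |∑ i, (C k i : ℤ) * x i| = M} < #{i | |x i| = M} := by
  set s : Finset ι := {j | x j < 0} with hs
  have hps : p ∉ s := by simp [hs, hp]
  have key : a p ≤ ∑ j ∈ s, a j := by
    rw [← sub_nonneg]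
    refine hG.unperforated M _ hM0 ?_
    have h1 : (M : ℤ) • a p + ∑ j ∈ s, x j • a j ≤ 0 := by
      rw [← hx, ← hp, ← Finset.add_sum_erase _ _ (Finset.mem_univ p)]
      refine add_le_add_right (sum_le_sum_of_subset_of_nonneg (fun j hj => ?_)
        fun j _ hj => ?_) _
      · exact mem_erase.2 ⟨fun h => hps (h ▸ hj), mem_univ j⟩
      · exact zsmul_nonneg (ha j) (by simpa [hs] using hj)
    have h2 : ∑ j ∈ s, (-(M : ℤ)) • a j ≤ ∑ j ∈ s, x j • a j := by
      refine Finset.sum_le_sum fun j _ => ?_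
      rw [← sub_nonneg, ← sub_smul]
      exact zsmul_nonneg (ha j) (by have := (abs_le.1 (hM j)).1; omega)
    have h3 : (M : ℤ) • a p + ∑ j ∈ s, (-(M : ℤ)) • a j ≤ 0 :=
      (add_le_add_right h2 _).trans h1
    rw [← Finset.smul_sum, neg_smul, natCast_zsmul, natCast_zsmul, ← neg_nonneg] at h3
    rw [smul_sub]
    convert h3 using 1
    abel
  obtain ⟨c, hc, hac⟩ := hG.decomp_sum s a (fun i _ => ha i) (a p) (ha p) key
  let c' : ι → G := fun j => if x j < 0 then c j else 0
  let b : ι ⊕ ι → G := Sum.elim (fun i => if i = p then 0 else a i - c' i) c'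
  let C : ι ⊕ ι → ι → ℕ := Sum.elim (fun k i => if i = k ∧ k ≠ p then 1 else 0)
    (fun k i => if x k < 0 then (if i = k then 1 else 0) + (if i = p then 1 else 0) else 0)
  have hinl : ∀ k, ∑ i, (C (Sum.inl k) i : ℤ) * x i = if k = p then 0 else x k := by
    intro k
    by_cases h : k = p <;> simp [C, h]
  have hinr : ∀ k, ∑ i, (C (Sum.inr k) i : ℤ) * x i = if x k < 0 then x k + M else 0 := by
    intro k
    by_cases h : x k < 0
    · simp [C, h, add_mul, Finset.sum_add_distrib, hp]
    · simp [C, h]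
  refine ⟨b, C, ?_, ?_, ?_, ?_⟩
  · rintro (k | k)
    · by_cases h : k = p
      · simp [b, h]
      · by_cases h' : x k < 0
        · simpa [b, h, c', h'] using (hc k (by simp [hs, h'])).2
        · simpa [b, h, c', h'] using ha k
    · by_cases h' : x k < 0
      · simpa [b, c', h'] using (hc k (by simp [hs, h'])).1
      · simp [b, c', h']
  · intro i
    rw [Fintype.sum_sum_type]
    by_cases h : i = p
    · subst h
      have h1 : ∀ k, C (Sum.inl k) i • b (Sum.inl k) = 0 := by
        intro k
        by_cases h : k = i
        · simp [C, h]
        · simp [C, Ne.symm h]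
      have h2 : ∀ k, C (Sum.inr k) i • b (Sum.inr k) = if k ∈ s then c k else 0 := by
        intro k
        by_cases h' : x k < 0
        · have : i ≠ k := by rintro rfl; omega
          simp [C, b, c', h', this, hs]
        · simp [C, h', hs]
      simp_rw [h1, h2]
      simp [hac]
    · have h1 : ∀ k, C (Sum.inl k) i • b (Sum.inl k) = if i = k then a i - c' i else 0 := by
        intro k
        by_cases h' : i = k
        · subst h'; simp [C, b, h]
        · simp [C, h']
      have h2 : ∀ k, C (Sum.inr k) i • b (Sum.inr k) = if i = k then c' i else 0 := by
        intro k
        by_cases h' : i = k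
        · subst h'
          by_cases h'' : x i < 0 <;> simp [C, b, c', h, h'']
        · by_cases h'' : x k < 0 <;> simp [C, h, h', h'']
      simp_rw [h1, h2]
      simp
  · rintro (k | k)
    · rw [hinl]; split_ifs
      · simp
      · exact hM k
    · rw [hinr]; split_ifs with h
      · have := abs_le.1 (hM k)
        rw [abs_le]; omega
      · simp
  · have : ({k | |∑ i, (C k i : ℤ) * x i| = M} : Finset (ι ⊕ ι)) ⊆
        ((({i | |x i| = M} : Finset ι).erase p).map Function.Embedding.inl) := by
      rintro (k | k)
      · simp only [mem_filter, mem_univ, true_and, hinl, mem_map, mem_erase,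
          Function.Embedding.inl_apply, Sum.inl.injEq, exists_eq_right]
        split_ifs with h
        · intro h0; simp at h0; omega
        · exact fun h0 => ⟨h, h0⟩
      · simp only [mem_filter, mem_univ, true_and, hinr]
        intro h0
        exfalso
        split_ifs at h0 with h
        · have := abs_le.1 (hM k)
          rcases abs_eq (by omega : (0:ℤ) ≤ M) |>.1 h0 with h1 | h1 <;> omega
        · simp at h0; omega
    refine (card_le_card this).trans_lt ?_
    rw [card_map]
    exact card_erase_lt_of_mem (by simp [hp])

lemma IsDimensionOrder.exists_kill_bounded (hG : IsDimensionOrder G) (M : ℕ) :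
    ∀ (N : ℕ) {ι : Type} [Fintype ι] (a : ι → G), (∀ i, 0 ≤ a i) → ∀ (x : ι → ℤ),
      ∑ i, x i • a i = 0 → (∀ i, |x i| ≤ M) → #{i | |x i| = M} ≤ N →
      ∃ (κ : Type) (_ : Fintype κ) (b : κ → G) (B : κ → ι → ℕ), (∀ k, 0 ≤ b k) ∧
        IsRefinement a b B ∧ ∀ k, ∑ i, (B k i : ℤ) * x i = 0 := by
  classical
  induction M with
  | zero =>
    intro N ι _ a ha x hx hM _
    refine ⟨ι, inferInstance, a, fun k i => if i = k then 1 else 0, ha, ?_, ?_⟩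
    · intro i; simp
    · intro k
      have : ∀ i, x i = 0 := fun i => by simpa using hM i
      simp [this]
  | succ M ihM =>
    intro N
    induction N with
    | zero =>
      intro ι _ a ha x hx hM hN
      refine ihM (Fintype.card ι) a ha x hx (fun i => ?_) (card_le_univ _)
      have h1 : |x i| ≠ (M + 1 : ℕ) := by
        intro h
        have : i ∈ ({i | |x i| = (M + 1 : ℕ)} : Finset ι) := by simp [h]
        rw [Nat.le_zero, card_eq_zero] at hN
        rw [hN] at this
        simp at this
      have h2 := hM i
      push_cast at h1 h2 ⊢
      omega
    | succ N ihN =>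
      intro ι _ a ha x hx hM hN
      by_cases hex : ∃ p, |x p| = (M + 1 : ℕ)
      · obtain ⟨p, hp⟩ := hex
        obtain ⟨ε, hε, hεp⟩ : ∃ ε : ℤ, |ε| = 1 ∧ ε * x p = (M + 1 : ℕ) := by
          rcases abs_cases (x p) with h | h
          · exact ⟨1, by simp, by omega⟩
          · exact ⟨-1, by simp, by omega⟩
        have habs : ∀ y : ℤ, |ε * y| = |y| := fun y => by rw [abs_mul, hε, one_mul]
        obtain ⟨b, C, hb, hC, hCM, hcard⟩ := hG.exists_kill_step (M + 1) a ha (fun i => ε * x i)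
          (by simp_rw [mul_smul]; rw [← smul_sum, hx, smul_zero])
          (fun i => by rw [habs]; exact hM i) p hεp (Nat.succ_pos _)
        have hrw : ∀ k, |∑ i, (C k i : ℤ) * (ε * x i)| = |∑ i, (C k i : ℤ) * x i| := by
          intro k
          rw [← habs (∑ i, (C k i : ℤ) * x i), mul_sum]
          congr 1; refine sum_congr rfl fun i _ => by ring
        simp only [hrw, habs] at hCM hcard
        obtain ⟨κ, _, b', B, hb', hB, hk⟩ := ihN b hb (fun k => ∑ i, (C k i : ℤ) * x i)
          (by rw [← hC.sum_zsmul, hx]) hCM (by omega)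
        refine ⟨κ, inferInstance, b', _, hb', hC.trans hB, fun k => ?_⟩
        rw [← hk k]
        push_cast
        simp_rw [sum_mul, mul_sum]
        rw [sum_comm]
        simp_rw [mul_assoc]
      · refine ihN a ha x hx hM ?_
        have : ({i | |x i| = (M + 1 : ℕ)} : Finset ι) = ∅ := by
          ext i; simpa using fun h => hex ⟨i, by exact_mod_cast h⟩
        rw [this]; simp

/-- Shen's property: a relation among positive elements can be made trivial by refining. -/
lemma IsDimensionOrder.exists_kill (hG : IsDimensionOrder G) {ι : Type} [Fintype ι]
    (a : ι → G) (ha : ∀ i, 0 ≤ a i) (x : ι → ℤ) (hx : ∑ i, x i • a i = 0) :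
    ∃ (κ : Type) (_ : Fintype κ) (b : κ → G) (B : κ → ι → ℕ), (∀ k, 0 ≤ b k) ∧
      IsRefinement a b B ∧ ∀ k, ∑ i, (B k i : ℤ) * x i = 0 := by
  refine hG.exists_kill_bounded (∑ i, (x i).natAbs) _ a ha x hx (fun i => ?_) le_rfl
  rw [Int.abs_eq_natAbs]
  exact_mod_cast single_le_sum (f := fun i => (x i).natAbs) (fun _ _ => Nat.zero_le _)
    (mem_univ i)

/-- All relations among finitely many positive elements can be made trivial at once. -/
lemma IsDimensionOrder.exists_kill_all (hG : IsDimensionOrder G) {ι : Type} [Fintype ι]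
    (a : ι → G) (ha : ∀ i, 0 ≤ a i) :
    ∃ (κ : Type) (_ : Fintype κ) (b : κ → G) (B : κ → ι → ℕ), (∀ k, 0 ≤ b k) ∧
      IsRefinement a b B ∧
      ∀ x : ι → ℤ, ∑ i, x i • a i = 0 → ∀ k, ∑ i, (B k i : ℤ) * x i = 0 := by
  classical
  let K : Submodule ℤ (ι → ℤ) :=
    { carrier := {x | ∑ i, x i • a i = 0}
      add_mem' := by
        intro x y hx hy
        simp only [Set.mem_ofPred_eq, Pi.add_apply, add_smul, sum_add_distrib] at *
        rw [hx, hy, add_zero]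
      zero_mem' := by simp
      smul_mem' := by
        intro c x hx
        simp only [Set.mem_ofPred_eq, Pi.smul_apply, smul_eq_mul, mul_smul, ← smul_sum] at *
        rw [hx, smul_zero] }
  obtain ⟨S, hS⟩ := IsNoetherian.noetherian K
  have hfin : ∀ T : Finset (ι → ℤ), (∀ x ∈ T, ∑ i, x i • a i = 0) →
      ∃ (κ : Type) (_ : Fintype κ) (b : κ → G) (B : κ → ι → ℕ), (∀ k, 0 ≤ b k) ∧
        IsRefinement a b B ∧ ∀ x ∈ T, ∀ k, ∑ i, (B k i : ℤ) * x i = 0 := by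
    intro T
    induction T using Finset.induction_on with
    | empty =>
      intro _
      exact ⟨ι, inferInstance, a, fun k i => if i = k then 1 else 0, ha, fun i => by simp,
        by simp⟩
    | insert y T _ ih =>
      intro hT
      obtain ⟨κ, _, b, B, hb, hB, hk⟩ := ih fun x hx => hT x (mem_insert_of_mem hx)
      obtain ⟨μ, _, c, C, hc, hC, hm⟩ := hG.exists_kill b hb (fun k => ∑ i, (B k i : ℤ) * y i)
        (by rw [← hB.sum_zsmul, hT y (mem_insert_self _ _)])
      have hcomp : ∀ (x : ι → ℤ) (r : μ), ∑ i, ((∑ k, C r k * B k i : ℕ) : ℤ) * x i =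
          ∑ k, (C r k : ℤ) * ∑ i, (B k i : ℤ) * x i := by
        intro x r
        push_cast
        simp_rw [sum_mul, mul_sum]
        rw [sum_comm]
        simp_rw [mul_assoc]
      refine ⟨μ, inferInstance, c, _, hc, hB.trans hC, fun x hx r => ?_⟩
      rw [hcomp]
      rcases mem_insert.1 hx with rfl | hx
      · exact hm r
      · exact sum_eq_zero fun k _ => by rw [hk x hx k, mul_zero]
  obtain ⟨κ, _, b, B, hb, hB, hk⟩ := hfin S fun x hx => by
    have : x ∈ K := hS ▸ Submodule.subset_span hx
    exact this
  refine ⟨κ, inferInstance, b, B, hb, hB, fun x hx k => ?_⟩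
  have hxK : x ∈ Submodule.span ℤ (S : Set (ι → ℤ)) := by rw [hS]; exact hx
  induction hxK using Submodule.span_induction with
  | mem y hy => exact hk y hy k
  | zero => simp
  | add x y hx' hy' ihx ihy =>
    rw [hS] at hx' hy'
    simp only [Pi.add_apply, mul_add, sum_add_distrib]
    rw [ihx hx', ihy hy', add_zero]
  | smul c x hx' ihx =>
    rw [hS] at hx'
    have := ihx hx'
    simp only [Pi.smul_apply, smul_eq_mul]
    rw [← mul_zero c, ← this, mul_sum]
    exact sum_congr rfl fun i _ => by ring

end DimensionGroup

section Divisibility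

/-- In a noncyclic rank-one subgroup every divisor of `u` has arbitrarily large multiples
that also divide `u`. -/
lemma exists_large_divisor {G : Type} [AddCommGroup G]
    (htf : ∀ (n : ℤ) (a : G), n ≠ 0 → n • a = 0 → a = 0) (H : AddSubgroup G)
    (hcyc : ¬ ∃ g ∈ H, ∀ x ∈ H, ∃ n : ℤ, x = n • g)
    (hrank : ∀ a ∈ H, ∀ b ∈ H, ∃ m n : ℤ, ¬ (m = 0 ∧ n = 0) ∧ m • a = n • b)
    {u : G} (huH : u ∈ H) (hu : u ≠ 0) (d : ℕ) (w : G) (hd : 0 < d) (hw : d • w = u) (M : ℕ) :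
    ∃ e w', M ≤ e ∧ (d * e) • w' = u := by
  by_contra! hno
  have hpos : ∀ e w', (d * e) • w' = u → 0 < e := by
    intro e w' h
    rcases Nat.eq_zero_or_pos e with rfl | h0
    · simp at h; exact absurd h.symm hu
    · exact h0
  obtain ⟨e, ⟨v, hv⟩, hmax⟩ : ∃ e, (∃ v, (d * e) • v = u) ∧
      ∀ e', (∃ v, (d * e') • v = u) → e' ≤ e := by
    classical
    let p : ℕ → Prop := fun e => ∃ v, (d * e) • v = u
    have hb : ∀ e, p e → e ≤ M := fun e ⟨v, hv⟩ => by
      by_contra! h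
      exact hno e v h.le hv
    have h1 : p 1 := ⟨w, by simpa using hw⟩
    exact ⟨Nat.findGreatest p M, Nat.findGreatest_spec (hb 1 h1) h1,
      fun e' he' => Nat.le_findGreatest (hb e' he') he'⟩
  have hgen : ∀ x ∈ H, ∃ n : ℤ, x = n • v := by
    intro x hx
    obtain ⟨n, k, hnk, hxu⟩ := hrank x hx u huH
    have hn : n ≠ 0 := by
      rintro rfl
      refine hu (htf k u (fun hk => hnk ⟨rfl, hk⟩) ?_)
      rw [← hxu, zero_smul]
    set D : ℤ := ((d * e : ℕ) : ℤ) with hD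
    have hDv : D • v = u := by rw [hD, natCast_zsmul, hv]
    have hDpos : 0 < D := by
      have := hpos e v hv
      rw [hD]; positivity
    -- write `k / (n)` and `1 / D` over the common denominator
    obtain ⟨n', k', g, hg, hcop, rfl, rfl⟩ : ∃ n' k' g : ℤ, g ≠ 0 ∧ IsCoprime n' k' ∧
        n = g * n' ∧ k = g * k' := by
      have hg : Int.gcd n k ≠ 0 := by simp [Int.gcd_eq_zero_iff, hn]
      obtain ⟨n', k', hc, h1, h2⟩ := Int.exists_gcd_one (Nat.pos_of_ne_zero hg)
      exact ⟨n', k', Int.gcd n k, by exact_mod_cast hg, Int.isCoprime_iff_gcd_eq_one.2 hc,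
        by rw [mul_comm]; exact h1, by rw [mul_comm]; exact h2⟩
    have hn' : n' ≠ 0 := right_ne_zero_of_mul hn
    have hxu' : n' • x = k' • u := by
      rw [← sub_eq_zero]
      refine htf g _ hg ?_
      rw [smul_sub, smul_smul, smul_smul, hxu, sub_self]
    obtain ⟨α, β, hαβ⟩ := hcop
    set z : G := α • u + β • x with hz
    have hnz : n' • z = u := by
      rw [hz, smul_add, smul_smul, smul_smul, mul_comm n' β, mul_smul β, hxu', smul_smul,
        ← add_smul, mul_comm n' α, hαβ, one_smul]
    have hkz : k' • z = x := by
      rw [hz, smul_add, smul_smul, smul_smul, mul_comm k' α, mul_smul α, ← hxu', smul_smul,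
        ← add_smul, mul_comm k' β, hαβ, one_smul]
    -- `n'` divides `D`
    obtain ⟨g', n₁, D₁, hg', ⟨a, b, hab⟩, hn₁, hD₁⟩ : ∃ g' n₁ D₁ : ℤ, g' ≠ 0 ∧ IsCoprime n₁ D₁ ∧
        n' = g' * n₁ ∧ D = g' * D₁ := by
      have hg : Int.gcd n' D ≠ 0 := by simp [Int.gcd_eq_zero_iff, hn']
      obtain ⟨n₁, D₁, hc, h1, h2⟩ := Int.exists_gcd_one (Nat.pos_of_ne_zero hg)
      exact ⟨Int.gcd n' D, n₁, D₁, by exact_mod_cast hg, Int.isCoprime_iff_gcd_eq_one.2 hc,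
        by rw [mul_comm]; exact h1, by rw [mul_comm]; exact h2⟩
    set t : G := a • v + b • z with ht
    have hlcm : (n₁ * D) • t = u := by
      have e1 : (n₁ * D) • (a • v) = (n₁ * a) • u := by
        rw [← hDv, smul_smul, smul_smul]; congr 1; ring
      have e2 : (n₁ * D) • (b • z) = (D₁ * b) • u := by
        rw [← hnz, smul_smul, smul_smul]; congr 1; rw [hD₁, hn₁]; ring
      rw [ht, smul_add, e1, e2, ← add_smul, mul_comm n₁, mul_comm D₁, hab, one_smul]
    have hn₁1 : n₁.natAbs ≤ 1 := by
      have h1 : (d * (e * n₁.natAbs)) • (n₁.sign • t) = u := by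
        rw [← natCast_zsmul, smul_smul, ← hlcm]
        congr 1
        push_cast
        rw [hD]
        push_cast
        have := Int.sign_mul_abs n₁
        calc (d : ℤ) * (e * |n₁|) * n₁.sign = (n₁.sign * |n₁|) * (d * e) := by ring
          _ = _ := by rw [this]
      have h2 := hmax _ ⟨_, h1⟩
      have h3 := hpos e v hv
      by_contra! h4
      nlinarith
    have hn₁0 : n₁ ≠ 0 := by rintro rfl; simp at hn₁; exact hn' hn₁
    have hdvd : ∃ f : ℤ, D = n' * f := by
      rcases Int.natAbs_eq n₁ with h | h
      · refine ⟨D₁, ?_⟩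
        rw [hn₁, hD₁]
        have : n₁ = 1 := by omega
        rw [this]; ring
      · refine ⟨-D₁, ?_⟩
        rw [hn₁, hD₁]
        have : n₁ = -1 := by omega
        rw [this]; ring
    obtain ⟨f, hf⟩ := hdvd
    have hzf : z = f • v := by
      rw [← sub_eq_zero]
      refine htf n' _ hn' ?_
      rw [smul_sub, hnz, smul_smul, ← hf, hDv, sub_self]
    exact ⟨k' * f, by rw [mul_smul, ← hzf, hkz]⟩
  -- `H` embeds in a cyclic group, hence is cyclic
  have hle : H ≤ AddSubgroup.zmultiples v := by
    intro x hx
    obtain ⟨n, rfl⟩ := hgen x hx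
    exact AddSubgroup.mem_zmultiples_iff.2 ⟨n, rfl⟩
  have : IsAddCyclic H := by
    have : IsAddCyclic (AddSubgroup.zmultiples v) := inferInstance
    exact isAddCyclic_of_injective (AddSubgroup.inclusion hle) (AddSubgroup.inclusion_injective hle)
  obtain ⟨⟨g, hgH⟩, hg⟩ := IsAddCyclic.exists_generator (α := H)
  refine hcyc ⟨g, hgH, fun x hx => ?_⟩
  obtain ⟨n, hn⟩ := AddSubgroup.mem_zmultiples_iff.1 (hg ⟨x, hx⟩)
  exact ⟨n, by simpa using (congrArg Subtype.val hn).symm⟩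

end Divisibility

section Splitting

open Finset

/-- A vector of weight `m * r` with large entries splits into `r` vectors of weight `m`, all of
whose entries are large. -/
lemma exists_balanced_split {κ : Type} [Fintype κ] [Nonempty κ] (c : κ → ℕ) (hc : ∀ k, 0 < c k) :
    ∃ g D : ℕ, 0 < g ∧ (∀ k, g ∣ c k) ∧ ∀ m, g ∣ m → ∀ (r M : ℕ) (B : κ → ℕ),
      ∑ k, c k * B k = m * r → (∀ k, (M + D) * r ≤ B k) →
      ∃ y : Fin r → κ → ℕ, (∀ p, ∑ k, c k * y p k = m) ∧ (∀ p k, M ≤ y p k) ∧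
        ∀ k, ∑ p, y p k = B k := by
  classical
  obtain ⟨e, he⟩ : ∃ e : κ → ℤ, ∑ k, (c k : ℤ) * e k = (univ.gcd fun k => (c k : ℤ)) := by
    obtain ⟨e, he⟩ := Finset.gcd_eq_sum_mul (univ : Finset κ) (fun k => (c k : ℤ))
    exact ⟨e, he.symm⟩
  set g := (univ.gcd fun k => (c k : ℤ)).natAbs with hg
  have hgg : (univ.gcd fun k => (c k : ℤ)) = g := by
    rw [hg]
    have := Finset.normalize_gcd (s := univ) (f := fun k => (c k : ℤ))
    rw [← Int.abs_eq_normalize] at this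
    rw [Int.natCast_natAbs, this]
  rw [hgg] at he
  have hgd : ∀ k, g ∣ c k := fun k => by
    have := Finset.gcd_dvd (f := fun k => (c k : ℤ)) (mem_univ k)
    rw [hgg] at this
    exact_mod_cast this
  have hg0 : 0 < g := Nat.pos_of_dvd_of_pos (hgd (Classical.arbitrary κ)) (hc _)
  set C := ∑ k, c k with hC
  refine ⟨g, C * ∑ k, (e k).natAbs, hg0, hgd, fun m hm r M B hB hBM => ?_⟩
  rcases Nat.eq_zero_or_pos r with rfl | hr
  · refine ⟨fun p => p.elim0, fun p => p.elim0, fun p => p.elim0, fun k => ?_⟩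
    have h0 : ∑ k, c k * B k = 0 := by simpa using hB
    have := (sum_eq_zero_iff.1 h0) k (mem_univ k)
    rcases Nat.mul_eq_zero.1 this with h | h
    · exact absurd h (hc k).ne'
    · simp [h]
  let χ : Fin r → κ → ℤ := fun p k => if (p : ℕ) < B k % r then 1 else 0
  have hχ : ∀ k, ∑ p, χ p k = (B k % r : ℕ) := by
    intro k
    have hlt := Nat.mod_lt (B k) hr
    simp only [χ, sum_boole]
    rw [Fin.card_filter_val_lt]
    omega
  let S : Fin r → ℤ := fun p => ∑ k, (c k : ℤ) * χ p k
  set s : ℤ := m - ∑ k, (c k : ℤ) * (B k / r : ℕ) with hs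
  have hSs : ∑ p, S p = r * s := by
    simp only [S]
    rw [sum_comm]
    simp_rw [← mul_sum, hχ]
    have hB' : ∑ k, (c k : ℤ) * (B k : ℤ) = m * r := by exact_mod_cast hB
    rw [hs, mul_sub, mul_sum, mul_comm (r : ℤ), ← hB', eq_sub_iff_add_eq, ← sum_add_distrib]
    refine sum_congr rfl fun k _ => ?_
    conv_rhs => rw [← Nat.mod_add_div (B k) r]
    push_cast
    ring
  have hS0 : ∀ p, 0 ≤ S p := fun p => sum_nonneg fun k _ => by
    simp only [χ]; split_ifs <;> simp
  have hSC : ∀ p, S p ≤ C := fun p => by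
    rw [hC]; push_cast
    refine sum_le_sum fun k _ => ?_
    simp only [χ]; split_ifs <;> simp
  have hr' : (0 : ℤ) < r := by exact_mod_cast hr
  have hs0 : 0 ≤ s := by
    have : 0 ≤ r * s := hSs ▸ sum_nonneg fun p _ => hS0 p
    exact nonneg_of_mul_nonneg_right this hr'
  have hsC : s ≤ C := by
    have : r * s ≤ r * C := by
      rw [← hSs]
      refine (sum_le_sum fun p _ => hSC p).trans ?_
      simp
    exact le_of_mul_le_mul_left this hr'
  have hgs : ∀ p, (g : ℤ) ∣ s - S p := by
    intro p
    have h1 : ∀ z : κ → ℤ, (g : ℤ) ∣ ∑ k, (c k : ℤ) * z k := fun z =>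
      dvd_sum fun k _ => Dvd.dvd.mul_right (by exact_mod_cast hgd k) _
    exact dvd_sub (dvd_sub (by exact_mod_cast hm) (h1 _)) (h1 _)
  choose t ht using hgs
  have hgz : (g : ℤ) ≠ 0 := by exact_mod_cast hg0.ne'
  have ht0 : ∑ p, t p = 0 := by
    refine (mul_eq_zero_iff_left hgz).1 ?_
    rw [mul_sum, ← sum_congr rfl fun p _ => ht p, sum_sub_distrib, hSs]
    simp
  have htC : ∀ p, |t p| ≤ C := by
    intro p
    have h1 : |(g : ℤ) * t p| ≤ C := by
      rw [← ht p, abs_le]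
      constructor <;> linarith [hS0 p, hSC p]
    rw [abs_mul, Nat.abs_cast] at h1
    have : (1 : ℤ) ≤ g := by exact_mod_cast hg0
    nlinarith [abs_nonneg (t p)]
  let y : Fin r → κ → ℤ := fun p k => (B k / r : ℕ) + χ p k + t p * e k
  have hy : ∀ p k, (M : ℤ) ≤ y p k := by
    intro p k
    have h1 : M + C * ∑ k, (e k).natAbs ≤ B k / r := (Nat.le_div_iff_mul_le hr).2 (hBM k)
    have h2 : (0 : ℤ) ≤ χ p k := by simp only [χ]; split_ifs <;> simp
    have h3 : |t p * e k| ≤ (C * ∑ k, (e k).natAbs : ℕ) := by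
      rw [abs_mul]
      push_cast
      refine mul_le_mul (htC p) ?_ (abs_nonneg _) (by positivity)
      exact single_le_sum (f := fun k => |e k|) (fun k _ => abs_nonneg _) (mem_univ k)
    have h4 := (abs_le.1 h3).1
    have h1' : ((M + C * ∑ k, (e k).natAbs : ℕ) : ℤ) ≤ (B k / r : ℕ) := by exact_mod_cast h1
    simp only [y]
    push_cast at *
    linarith
  have hyn : ∀ p k, (((y p k).toNat : ℕ) : ℤ) = y p k := fun p k =>
    Int.toNat_of_nonneg ((Int.natCast_nonneg M).trans (hy p k))
  refine ⟨fun p k => (y p k).toNat, fun p => ?_, fun p k => ?_, fun k => ?_⟩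
  · zify
    simp_rw [hyn]
    simp only [y, mul_add, sum_add_distrib]
    have : ∑ k, (c k : ℤ) * (t p * e k) = s - S p := by
      rw [ht p, ← he, sum_mul]
      exact sum_congr rfl fun k _ => by ring
    rw [this, hs]
    simp only [S]
    ring
  · have := hy p k
    rw [← hyn] at this
    exact_mod_cast this
  · zify
    simp_rw [hyn]
    simp only [y, sum_add_distrib, hχ, ← sum_mul, ht0]
    simp only [sum_const, card_univ, Fintype.card_fin, nsmul_eq_mul, zero_mul, add_zero]
    conv_rhs => rw [← Nat.mod_add_div (B k) r]
    push_cast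
    ring

end Splitting

section Stages

open Finset

variable {G : Type} [AddCommGroup G] [PartialOrder G] [IsOrderedAddMonoid G]

lemma IsDimensionOrder.eq_zero_of_nsmul (hG : IsDimensionOrder G) {n : ℕ} (hn : 0 < n) {a : G}
    (h : n • a = 0) : a = 0 :=
  le_antisymm (neg_nonneg.1 (hG.unperforated n _ hn (by rw [smul_neg, h, neg_zero])))
    (hG.unperforated n a hn h.ge)

/-- A refinement of a positive family into a positive family that kills all relations and
generates a prescribed positive element. -/
lemma IsDimensionOrder.exists_refinement (hG : IsDimensionOrder G)
    (hs : ∀ a : G, 0 < a → ∀ b, ∃ n : ℕ, b ≤ n • a) {ι : Type} [Fintype ι] [Nonempty ι]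
    (a : ι → G) (ha : ∀ i, 0 < a i) (g : G) (hg : 0 ≤ g) :
    ∃ (κ : Type) (_ : Fintype κ) (b : κ → G) (B : κ → ι → ℕ) (γ : κ → ℕ), (∀ k, 0 < b k) ∧
      (∀ k, 0 < ∑ i, B k i) ∧ IsRefinement a b B ∧
      (∀ x : ι → ℤ, ∑ i, x i • a i = 0 → ∀ k, ∑ i, (B k i : ℤ) * x i = 0) ∧
      g = ∑ k, γ k • b k := by
  classical
  obtain ⟨i₀⟩ := ‹Nonempty ι›
  obtain ⟨n, hn⟩ := hs (a i₀) (ha i₀) g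
  let f : ι ⊕ Fin 2 → G := Sum.elim a ![g, n • a i₀ - g]
  have hf : ∀ j, 0 ≤ f j := by
    rintro (i | j)
    · exact (ha i).le
    · fin_cases j
      · exact hg
      · exact sub_nonneg.2 hn
  obtain ⟨κ, _, b, B, hb, hB, hkill⟩ := hG.exists_kill_all f hf
  have hc : ∀ k, ∑ i, B k (Sum.inl i) = 0 → B k (Sum.inr 0) = 0 := by
    intro k hk
    have h := hkill (Sum.elim (fun i => if i = i₀ then -(n : ℤ) else 0) ![1, 1])
      (by simp [f, Fintype.sum_sum_type, ite_smul]) k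
    simp only [Fintype.sum_sum_type, Sum.elim_inl, Sum.elim_inr, Fin.sum_univ_two] at h
    have h0 : ∀ i, B k (Sum.inl i) = 0 := fun i => sum_eq_zero_iff.1 hk i (mem_univ i)
    simp [h0] at h
    omega
  let p : κ → Prop := fun k => b k ≠ 0 ∧ ∑ i, B k (Sum.inl i) ≠ 0
  have hsub : ∀ z : κ → ℕ, (∀ k, ∑ i, B k (Sum.inl i) = 0 → z k = 0) →
      ∑ k, z k • b k = ∑ k : {k // p k}, z k • b k := by
    intro z hz
    rw [← sum_subtype (univ.filter p) (by simp) fun k => z k • b k]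
    refine (sum_filter_of_ne fun k _ h => ?_).symm
    exact ⟨right_ne_zero_of_smul h, fun h0 => left_ne_zero_of_smul h (hz k h0)⟩
  refine ⟨{k // p k}, inferInstance, fun k => b k, fun k i => B k (Sum.inl i),
    fun k => B k (Sum.inr 0), fun k => (hb k).lt_of_ne' k.2.1,
    fun k => Nat.pos_of_ne_zero k.2.2, fun i => ?_, fun x hx k => ?_, ?_⟩
  · have := hB (Sum.inl i)
    rw [hsub _ fun k hk => sum_eq_zero_iff.1 hk i (mem_univ i)] at this
    exact this
  · have := hkill (Sum.elim x 0) (by simpa [f, Fintype.sum_sum_type] using hx) k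
    simpa [Fintype.sum_sum_type] using this
  · have := hB (Sum.inr 0)
    rw [hsub _ hc] at this
    exact this

/-- A refinement whose rows all have the same weight and large entries. -/
lemma IsDimensionOrder.exists_balanced_refinement (hG : IsDimensionOrder G)
    (hs : ∀ a : G, 0 < a → ∀ b, ∃ n : ℕ, b ≤ n • a) {u : G}
    (hdiv : ∀ (d : ℕ) (w : G), 0 < d → d • w = u → ∀ M : ℕ, ∃ e w', M ≤ e ∧ (d * e) • w' = u)
    {κ : Type} [Fintype κ] [Nonempty κ] (b : κ → G) (hb : ∀ k, 0 < b k) (c : κ → ℕ)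
    (hc : ∀ k, 0 < c k) {q : ℕ} (hq : 0 < q) (hqu : q • ∑ k, c k • b k = u) (M N : ℕ) :
    ∃ (m : ℕ) (μ : Type) (_ : Fintype μ) (d : μ → G) (y : μ → κ → ℕ), N ≤ m ∧
      (∀ l, 0 < d l) ∧ IsRefinement b d y ∧ (∀ l, ∑ k, c k * y l k = m) ∧
      (∀ l k, M ≤ y l k) ∧ Fintype.card μ ≤ (m + 1) ^ Fintype.card κ := by
  classical
  obtain ⟨g, D, hg, hgc, hsplit⟩ := exists_balanced_split c hc
  set M₁ := M + D with hM₁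
  set v₀ := ∑ k, c k • b k with hv₀
  have hv₀0 : 0 ≤ v₀ := sum_nonneg fun k _ => nsmul_nonneg (hb k).le _
  choose n hn using fun k => hs (b k) (hb k) (M₁ • v₀)
  obtain ⟨e, v, hle, hev⟩ := hdiv (q * g) (∑ k, (c k / g) • b k) (Nat.mul_pos hq hg) (by
    rw [mul_smul, smul_sum, ← hqu]
    congr 1
    refine sum_congr rfl fun k _ => ?_
    rw [smul_smul, Nat.mul_div_cancel' (hgc k)]) (∑ k, n k + N + 1)
  have he : 0 < e := by omega
  have hmv : (g * e) • v = v₀ := by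
    rw [← sub_eq_zero]
    refine hG.eq_zero_of_nsmul hq ?_
    rw [smul_sub, smul_smul, hqu, ← mul_assoc, hev, sub_self]
  have hv : 0 ≤ v := hG.unperforated (g * e) v (Nat.mul_pos hg he) (hmv ▸ hv₀0)
  have hMv : ∀ k, M₁ • v ≤ b k := by
    intro k
    rw [← sub_nonneg]
    refine hG.unperforated e _ he ?_
    rw [smul_sub, sub_nonneg]
    calc e • M₁ • v ≤ g • e • M₁ • v :=
          le_self_nsmul (nsmul_nonneg (nsmul_nonneg hv _) _) hg.ne'
      _ = M₁ • v₀ := by rw [← hmv, smul_smul, smul_smul, smul_smul]; congr 1; ring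
      _ ≤ n k • b k := hn k
      _ ≤ e • b k := nsmul_le_nsmul_left (hb k).le (by
          have := single_le_sum (f := n) (fun _ _ => Nat.zero_le _) (mem_univ k)
          omega)
  obtain ⟨μ, _, d, B, hd, hB, hkill⟩ := hG.exists_kill
    (fun o : Option κ => o.elim v fun k => b k - M₁ • v)
    (by rintro (_ | k); exacts [hv, sub_nonneg.2 (hMv k)])
    (fun o => o.elim ((M₁ * ∑ k, c k : ℕ) - (g * e : ℕ) : ℤ) fun k => (c k : ℤ)) (by
      simp only [Fintype.sum_option, Option.elim_none, Option.elim_some, sub_smul, smul_sub,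
        natCast_zsmul, sum_sub_distrib, hmv, ← hv₀]
      rw [mul_comm, mul_smul, sum_smul]
      abel)
  let B' : μ → κ → ℕ := fun l k => B l (some k) + M₁ * B l none
  have hw : ∀ l, ∑ k, c k * B' l k = (g * e) * B l none := by
    intro l
    have := hkill l
    simp only [Fintype.sum_option, Option.elim_none, Option.elim_some] at this
    zify
    simp only [B', mul_add, Nat.cast_add, sum_add_distrib, Nat.cast_mul]
    push_cast at this
    rw [← sub_eq_zero, ← this, sum_congr rfl fun k _ => mul_comm (c k : ℤ) (B l (some k))]
    simp_rw [← mul_assoc, mul_comm _ (M₁ : ℤ), mul_assoc, ← mul_sum, ← sum_mul]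
    ring
  choose Y hYw hYM hYs using fun l => hsplit (g * e) (dvd_mul_right g e) (B l none) M (B' l) (hw l)
    (fun k => Nat.le_add_left _ _)
  let rows : Finset (κ → ℕ) := univ.image fun σ : Σ l, Fin (B l none) => Y σ.1 σ.2
  let d' : (κ → ℕ) → G := fun y => ∑ σ : Σ l, Fin (B l none) with Y σ.1 σ.2 = y, d σ.1
  have hd' : ∀ y, 0 ≤ d' y := fun y => sum_nonneg fun σ _ => hd _
  have hmem : ∀ y ∈ rows, ∃ l p, Y l p = y := by
    intro y hy
    obtain ⟨σ, -, rfl⟩ := mem_image.1 hy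
    exact ⟨σ.1, σ.2, rfl⟩
  have hrow : ∀ y ∈ rows, ∑ k, c k * y k = g * e := by
    intro y hy
    obtain ⟨l, p, rfl⟩ := hmem y hy
    exact hYw l p
  let S : Finset (κ → ℕ) := rows.filter fun y => d' y ≠ 0
  refine ⟨g * e, S, inferInstance, fun y => d' y, fun y => y, ?_, fun y => ?_, fun k => ?_,
    fun y => hrow _ (mem_filter.1 y.2).1, fun y k => ?_, ?_⟩
  · exact (show N ≤ e by omega).trans (Nat.le_mul_of_pos_left _ hg)
  · exact (hd' _).lt_of_ne' (mem_filter.1 y.2).2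
  · have h1 := hB (some k)
    have h2 := hB none
    simp only [Option.elim_none, Option.elim_some] at h1 h2
    calc b k = (b k - M₁ • v) + M₁ • v := by abel
      _ = ∑ l, B' l k • d l := by
        rw [h1, h2, smul_sum, ← sum_add_distrib]
        exact sum_congr rfl fun l _ => by simp only [B']; rw [add_smul (B l (some k)), mul_smul]
      _ = ∑ σ : Σ l, Fin (B l none), Y σ.1 σ.2 k • d σ.1 := by
        rw [Fintype.sum_sigma]
        exact sum_congr rfl fun l _ => by rw [← hYs l k, sum_smul]
      _ = ∑ y ∈ rows, y k • d' y := by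
        rw [← sum_fiberwise_of_maps_to (t := rows) (g := fun σ => Y σ.1 σ.2)
          (fun σ _ => mem_image_of_mem _ (mem_univ σ))]
        refine sum_congr rfl fun y _ => ?_
        rw [smul_sum]
        exact sum_congr rfl fun σ hσ => by rw [(mem_filter.1 hσ).2]
      _ = ∑ y ∈ S, y k • d' y := by
        refine (sum_filter_of_ne fun y _ h => ?_).symm
        exact right_ne_zero_of_smul h
      _ = ∑ y : S, (y : κ → ℕ) k • d' y := (sum_coe_sort S fun y => y k • d' y).symm
  · obtain ⟨l, p, h⟩ := hmem _ (mem_filter.1 y.2).1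
    change M ≤ (y : κ → ℕ) k
    rw [← h]
    exact hYM l p k
  · rw [Fintype.card_coe]
    calc #S ≤ #rows := card_filter_le _ _
      _ ≤ #(Fintype.piFinset fun _ : κ => range (g * e + 1)) := by
        refine card_le_card fun y hy => Fintype.mem_piFinset.2 fun k => mem_range_succ_iff.2 ?_
        calc y k ≤ c k * y k := Nat.le_mul_of_pos_left _ (hc k)
          _ ≤ ∑ k, c k * y k := single_le_sum (f := fun k => c k * y k)
            (fun _ _ => Nat.zero_le _) (mem_univ k)
          _ = g * e := hrow y hy
      _ = _ := by simp

/-- A finite family of positive elements whose sum is the `q`-th part of `u`. -/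
structure Stage (u : G) : Type 1 where
  ι : Type
  [fin : Fintype ι]
  a : ι → G
  q : ℕ
  q_pos : 0 < q
  pos : ∀ i, 0 < a i
  sum : q • ∑ i, a i = u

attribute [instance] Stage.fin

/-- `s'` refines `s` by the matrix `y`, whose rows have sum `m` and entries at least `M`;
relations of `s` are killed by `y`, `g` is generated by `s'`, and `s'` has few elements. -/
structure Stage.IsStep {u : G} (g : G) (M N : ℕ) (ε : ℝ) (s s' : Stage u) (m : ℕ)
    (y : s'.ι → s.ι → ℕ) : Prop where
  q_eq : s'.q = s.q * m
  le : N ≤ m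
  le_entry : ∀ r i, M ≤ y r i
  row_sum : ∀ r, ∑ i, y r i = m
  refinement : IsRefinement s.a s'.a y
  kill : ∀ x : s.ι → ℤ, ∑ i, x i • s.a i = 0 → ∀ r, ∑ i, (y r i : ℤ) * x i = 0
  generates : ∃ γ : s'.ι → ℕ, g = ∑ r, γ r • s'.a r
  card_le : (Fintype.card s'.ι : ℝ) ≤ Real.exp (ε * m)

lemma Stage.nonempty {G : Type} [AddCommGroup G] [PartialOrder G] {u : G} (hu : u ≠ 0) (s : Stage u) : Nonempty s.ι := by
  by_contra h
  rw [not_nonempty_iff] at h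
  exact hu (by rw [← s.sum]; simp)

lemma eventually_pow_le_exp (k : ℕ) {ε : ℝ} (hε : 0 < ε) :
    ∀ᶠ m : ℕ in Filter.atTop, ((m : ℝ) + 1) ^ k ≤ Real.exp (ε * m) := by
  have h := (isLittleO_pow_exp_pos_mul_atTop k hε).bound (Real.exp_pos (-ε))
  have h1 : Filter.Tendsto (fun m : ℕ => (m : ℝ) + 1) Filter.atTop Filter.atTop :=
    Filter.tendsto_atTop_add_const_right _ _ tendsto_natCast_atTop_atTop
  filter_upwards [h1.eventually h] with m hm
  rw [Real.norm_of_nonneg (by positivity), Real.norm_of_nonneg (Real.exp_pos _).le,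
    ← Real.exp_add] at hm
  refine hm.trans (le_of_eq ?_)
  congr 1
  ring

lemma IsDimensionOrder.exists_isStep (hG : IsDimensionOrder G)
    (hs : ∀ a : G, 0 < a → ∀ b, ∃ n : ℕ, b ≤ n • a) {u : G} (hu : 0 < u)
    (hdiv : ∀ (d : ℕ) (w : G), 0 < d → d • w = u → ∀ M : ℕ, ∃ e w', M ≤ e ∧ (d * e) • w' = u)
    (g : G) (hg : 0 ≤ g) (M N : ℕ) (ε : ℝ) (hε : 0 < ε) (s : Stage u) :
    ∃ s' m y, s.IsStep g M N ε s' m y := by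
  have := s.nonempty hu.ne'
  obtain ⟨κ, _, b, B, γ, hb, hc, hB, hkill, hγ⟩ := hG.exists_refinement hs s.a s.pos g hg
  have hsum : ∑ i, s.a i = ∑ k, (∑ i, B k i) • b k := by
    simp_rw [sum_smul]
    rw [sum_comm]
    exact sum_congr rfl fun i _ => hB i
  have hκ : Nonempty κ := by
    by_contra h
    rw [not_nonempty_iff] at h
    exact hu.ne' (by rw [← s.sum, hsum]; simp)
  have hBi : ∀ i, ∃ k, 0 < B k i := by
    intro i
    by_contra! h
    refine (s.pos i).ne' ?_
    rw [hB i]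
    exact sum_eq_zero fun k _ => by rw [Nat.le_zero.1 (h k), zero_smul]
  obtain ⟨N₀, hN₀⟩ := Filter.eventually_atTop.1 (eventually_pow_le_exp (Fintype.card κ) hε)
  obtain ⟨m, μ, _, d, y, hm, hd, hy, hym, hyM, hcard⟩ :=
    hG.exists_balanced_refinement hs hdiv b hb _ hc s.q_pos (hsum ▸ s.sum) M (N + N₀ + 1)
  have hmd : ∑ i, s.a i = m • ∑ l, d l := by
    rw [hsum, smul_sum]
    simp_rw [hy _, smul_sum]
    rw [sum_comm]
    refine sum_congr rfl fun l _ => ?_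
    rw [← hym l, sum_smul]
    exact sum_congr rfl fun k _ => by rw [smul_smul]
  refine ⟨⟨μ, d, s.q * m, Nat.mul_pos s.q_pos (by omega), hd, by
    rw [mul_smul, ← hmd, s.sum]⟩, m, fun l i => ∑ k, y l k * B k i, ?_⟩
  refine ⟨rfl, by omega, fun l i => ?_, fun l => ?_, hB.trans hy, fun x hx l => ?_,
    ⟨fun l => ∑ k, γ k * y l k, ?_⟩, ?_⟩
  · obtain ⟨k, hk⟩ := hBi i
    calc M ≤ y l k := hyM l k
      _ ≤ y l k * B k i := Nat.le_mul_of_pos_right _ hk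
      _ ≤ _ := single_le_sum (f := fun k => y l k * B k i) (fun _ _ => Nat.zero_le _) (mem_univ k)
  · rw [sum_comm, ← hym l]
    refine sum_congr rfl fun k _ => ?_
    rw [← mul_sum, mul_comm]
  · push_cast
    simp_rw [sum_mul]
    rw [sum_comm]
    refine sum_eq_zero fun k _ => ?_
    simp_rw [mul_assoc, ← mul_sum, hkill x hx k, mul_zero]
  · rw [hγ]
    simp_rw [hy _, smul_sum, sum_smul]
    rw [sum_comm]
    exact sum_congr rfl fun l _ => sum_congr rfl fun k _ => by rw [smul_smul]
  · refine le_trans ?_ (hN₀ m (by omega))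
    exact_mod_cast hcard

lemma IsDimensionOrder.exists_stages (hG : IsDimensionOrder G)
    (hs : ∀ a : G, 0 < a → ∀ b, ∃ n : ℕ, b ≤ n • a) {u : G} (hu : 0 < u)
    (hdiv : ∀ (d : ℕ) (w : G), 0 < d → d • w = u → ∀ M : ℕ, ∃ e w', M ≤ e ∧ (d * e) • w' = u)
    (g : ℕ → G) (hg : ∀ n, 0 ≤ g n) (M N : ℕ → ℕ → ℕ → ℕ) (ε : ℕ → ℕ → ℕ → ℝ)
    (hε : ∀ n q l, 0 < ε n q l) :
    ∃ (S : ℕ → Stage u) (m : ℕ → ℕ) (y : ∀ n, (S (n + 1)).ι → (S n).ι → ℕ), (S 0).q = 1 ∧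
      ∀ n, (S n).IsStep (g n) (M n (S n).q (Fintype.card (S n).ι))
        (N n (S n).q (Fintype.card (S n).ι)) (ε n (S n).q (Fintype.card (S n).ι))
        (S (n + 1)) (m n) (y n) := by
  choose next m y h using fun n (s : Stage u) =>
    hG.exists_isStep hs hu hdiv (g n) (hg n) (M n s.q (Fintype.card s.ι))
      (N n s.q (Fintype.card s.ι)) (ε n s.q (Fintype.card s.ι)) (hε _ _ _) s
  let s₀ : Stage u := ⟨Unit, fun _ => u, 1, one_pos, fun _ => hu, by simp⟩
  let S : ℕ → Stage u := fun n => Nat.rec s₀ next n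
  exact ⟨S, fun n => m n (S n), fun n => y n (S n), rfl, fun n => h n (S n)⟩

end Stages

section Words

open Finset

lemma exists_equiv_of_ne {α β : Type} (e : α ≃ β) {a b : α} {x y : β} (hab : a ≠ b)
    (hxy : x ≠ y) : ∃ e' : α ≃ β, e' a = x ∧ e' b = y := by
  classical
  let e₁ := e.trans (Equiv.swap (e a) x)
  have h₁ : e₁ a = x := by simp [e₁]
  refine ⟨e₁.trans (Equiv.swap (e₁ b) y), ?_, by simp⟩
  have hb : x ≠ e₁ b := by rw [← h₁]; exact e₁.injective.ne hab
  rw [Equiv.trans_apply, h₁, Equiv.swap_apply_of_ne_of_ne hb hxy]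

/-- There are many words of length `m` with the same letter counts, in which the marker `(i₀, 0)`
occurs exactly at the first position, `(i₀, 1)` occurs at the last one, and every letter occurs. -/
lemma exists_words {ι : Type} [Fintype ι] [DecidableEq ι] (i₀ : ι) (N m C : ℕ) (y : ι → ℕ)
    (hy : ∀ i, N + 3 ≤ y i) (hm : ∑ i, y i = m)
    (hC0 : 0 < C)
    (hC : C * (m + 1) ^ (Fintype.card ι * (N + 2)) ≤
      (N + 1) ^ (m - Fintype.card ι * (N + 2) - 1)) :
    ∃ (Y : ι × Fin (N + 2) → ℕ) (w : Fin C → Fin m → ι × Fin (N + 2)), Function.Injective w ∧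
      (∀ c v, #{j | w c j = v} = Y v) ∧ (∀ i, ∑ s, Y (i, s) = y i) ∧
      (∀ c (j : Fin m), w c j = (i₀, 0) ↔ (j : ℕ) = 0) ∧
      (∀ c (j : Fin m), (j : ℕ) + 1 = m → w c j = (i₀, 1)) ∧
      ∀ c v, ∃ j, w c j = v := by
  let F : ι → ℕ := fun i => y i - (N + 2) - if i = i₀ then 1 else 0
  have hF : ∀ i, (N + 2) + F i + (if i = i₀ then 1 else 0) = y i := by
    intro i
    have := hy i
    simp only [F]
    split_ifs <;> omega
  have hmF : Fintype.card ι * (N + 2) + ∑ i, F i + 1 = m := by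
    rw [← hm, ← sum_congr rfl fun i _ => hF i, sum_add_distrib, sum_add_distrib]
    simp
  have hm2 : 2 ≤ m := by
    have : 0 < Fintype.card ι := Fintype.card_pos_iff.2 ⟨i₀⟩
    have := Nat.mul_le_mul this (le_add_self : 2 ≤ N + 2)
    omega
  have hcard : Fintype.card (((ι × Fin (N + 2)) ⊕ (Σ i, Fin (F i))) ⊕ Unit) = m := by
    rw [← hmF]; simp
  obtain ⟨e, he0, hel⟩ := exists_equiv_of_ne (Fintype.equivFinOfCardEq hcard)
    (a := Sum.inl (Sum.inl (i₀, 0))) (b := Sum.inr ()) (x := ⟨0, by omega⟩)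
    (y := ⟨m - 1, by omega⟩) (by simp) (by simp; omega)
  let g : ((Σ i, Fin (F i)) → Fin (N + 1)) →
      ((ι × Fin (N + 2)) ⊕ (Σ i, Fin (F i))) ⊕ Unit → ι × Fin (N + 2) := fun f =>
    Sum.elim (Sum.elim id fun p => (p.1, (f p).succ)) fun _ => (i₀, 1)
  have hg0 : ∀ f p, g f p = (i₀, 0) ↔ p = Sum.inl (Sum.inl (i₀, 0)) := by
    rintro f ((v | p) | p) <;> simp [g]
  have hgi : ∀ f i, ∑ p, (if (g f p).1 = i then 1 else 0) = y i := by
    intro f i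
    rw [← hF i]
    simp only [Fintype.sum_sum_type, Fintype.sum_prod_type, Fintype.sum_sigma, g,
      Sum.elim_inl, Sum.elim_inr, id]
    simp [eq_comm]
    congr
  let w : ((Σ i, Fin (F i)) → Fin (N + 1)) → Fin m → ι × Fin (N + 2) := fun f j => g f (e.symm j)
  have hw : Function.Injective w := by
    intro f f' h
    funext p
    have := congrFun h (e (Sum.inl (Sum.inr p)))
    simpa [w, g] using this
  let cnt : ((Σ i, Fin (F i)) → Fin (N + 1)) → ι × Fin (N + 2) → ℕ := fun f v => #{j | w f j = v}
  obtain ⟨Y, -, hY⟩ : ∃ Y ∈ Fintype.piFinset fun _ : ι × Fin (N + 2) => range (m + 1),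
      C ≤ #{f | cnt f = Y} := by
    refine exists_le_card_fiber_of_mul_le_card_of_maps_to (s := univ) (fun f _ => ?_) ?_ ?_
    · refine Fintype.mem_piFinset.2 fun v => mem_range_succ_iff.2 ?_
      exact (card_le_univ _).trans (by simp)
    · exact ⟨fun _ => 0, by simp⟩
    · have : m - Fintype.card ι * (N + 2) - 1 = ∑ i, F i := by omega
      rw [this] at hC
      simpa [mul_comm] using hC
  obtain ⟨t, ht, htC⟩ := exists_subset_card_eq hY
  let ψ := t.equivFinOfCardEq htC
  have hψ : ∀ c, cnt (ψ.symm c) = Y := fun c => by simpa using ht (ψ.symm c).2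
  refine ⟨Y, fun c => w (ψ.symm c), fun c c' h => ?_, fun c v => congrFun (hψ c) v, fun i => ?_,
    fun c j => ?_, fun c j hj => ?_, fun c v => ⟨e (Sum.inl (Sum.inl v)), by simp [w, g]⟩⟩
  · exact ψ.symm.injective (Subtype.ext (hw h))
  · let c : Fin C := ⟨0, hC0⟩
    rw [← hgi (ψ.symm c) i, ← e.symm.sum_comp, ← hψ c]
    simp only [cnt, card_eq_sum_ones, sum_filter]
    rw [sum_comm]
    refine sum_congr rfl fun j _ => ?_
    rw [← Fintype.sum_ite_eq (g (ψ.symm c) (e.symm j)).2 fun _ =>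
      if (g (ψ.symm c) (e.symm j)).1 = i then 1 else 0]
    refine sum_congr rfl fun s _ => ?_
    simp only [w, Prod.ext_iff]
    split_ifs <;> simp_all
  · rw [hg0, Equiv.symm_apply_eq, he0, Fin.ext_iff]
  · have : j = ⟨m - 1, by omega⟩ := Fin.ext (by simp; omega)
    simp [w, this, ← hel, g]

end Words

/-- A sequence of finite alphabets with constant-length substitutions between them. Every
substituted word starts with `α`, which occurs nowhere else in it, ends with `β` and contains
every letter. -/
structure BlockSystem : Type 1 where
  V : ℕ → Type
  [fin : ∀ n, Fintype (V n)]
  m : ℕ → ℕ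
  two_le : ∀ n, 2 ≤ m n
  W : ∀ n, V (n + 1) → ℕ → V n
  α : ∀ n, V n
  β : ∀ n, V n
  W_eq_α : ∀ n v j, j < m n → (W n v j = α n ↔ j = 0)
  W_last : ∀ n v, W n v (m n - 1) = β n
  W_inj : ∀ n v v', (∀ j < m n, W n v j = W n v' j) → v = v'
  W_occ : ∀ n v x, ∃ j < m n, W n v j = x

namespace BlockSystem

attribute [instance] BlockSystem.fin

variable (S : BlockSystem)

/-- The length of the words of level `n` in the alphabet of level `0`. -/
def q (n : ℕ) : ℕ := ∏ i ∈ Finset.range n, S.m i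

/-- The `d`-fold substitution of the sequence `… β β . α α …` of level `n + d`. -/
def expand : ∀ n : ℕ, ℕ → ℤ → S.V n
  | n, 0, k => if 0 ≤ k then S.α n else S.β n
  | n, d + 1, k => S.W n (expand (n + 1) d (k / S.m n)) (k % S.m n).toNat

/-- The limit sequence of level `n`. -/
def seq (n : ℕ) (k : ℤ) : S.V n := S.expand n k.natAbs k

lemma m_pos (n : ℕ) : (0 : ℤ) < S.m n := by have := S.two_le n; omega

@[simp] lemma q_zero : S.q 0 = 1 := by simp [q]

lemma q_succ (n : ℕ) : S.q (n + 1) = S.q n * S.m n := by simp [q, Finset.prod_range_succ]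

lemma lt_q (n : ℕ) : n < S.q n := by
  induction n with
  | zero => simp
  | succ n ih =>
    rw [q_succ]
    have := S.two_le n
    nlinarith

lemma q_pos (n : ℕ) : (0 : ℤ) < S.q n := by have := S.lt_q n; omega

lemma ediv_mem_range {m d : ℕ} (hm : 2 ≤ m) {k : ℤ} (h1 : -(d + 2 : ℤ) ≤ k)
    (h2 : k ≤ d + 1) : -(d + 1 : ℤ) ≤ k / m ∧ k / m ≤ d := by
  have hm' : (2 : ℤ) ≤ m := by exact_mod_cast hm
  constructor
  · rw [Int.le_ediv_iff_mul_le (by omega)]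
    nlinarith
  · rw [← Int.lt_add_one_iff, Int.ediv_lt_iff_lt_mul (by omega)]
    nlinarith

lemma expand_succ (d : ℕ) : ∀ (n : ℕ) (k : ℤ), -(d + 1 : ℤ) ≤ k → k ≤ d →
    S.expand n (d + 1) k = S.expand n d k := by
  induction d with
  | zero =>
    intro n k h1 h2
    have hm := S.two_le n
    obtain rfl | rfl : k = 0 ∨ k = -1 := by norm_num at h1 h2; omega
    · simp [expand, S.W_eq_α n _ 0 (by omega)]
    · have e1 : (-1 : ℤ) / S.m n = -1 := by
        rw [Int.neg_one_ediv, Int.sign_eq_one_of_pos (S.m_pos n)]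
      have e2 : ((-1 : ℤ) % S.m n).toNat = S.m n - 1 := by
        have : (-1 : ℤ) % S.m n = S.m n - 1 := by
          rw [Int.emod_def, e1]; ring
        omega
      simp [expand, e2, S.W_last]
  | succ d ih =>
    intro n k h1 h2
    have := ediv_mem_range (S.two_le n) (d := d) (k := k) (by push_cast at h1; linarith)
      (by push_cast at h2; linarith)
    rw [expand, ih _ _ this.1 this.2]
    rfl

lemma expand_eq_seq (n d : ℕ) (k : ℤ) (h : k.natAbs ≤ d) : S.expand n d k = S.seq n k := by
  induction d, h using Nat.le_induction with
  | base => rfl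
  | succ d hd ih => rw [← ih, S.expand_succ d n k (by omega) (by omega)]

lemma seq_eq (n : ℕ) (k : ℤ) :
    S.seq n k = S.W n (S.seq (n + 1) (k / S.m n)) (k % S.m n).toNat := by
  rw [← S.expand_eq_seq n (k.natAbs + 1) k (by omega), expand, expand_eq_seq]
  exact Int.natAbs_ediv_le_natAbs _ _

lemma seq_mul_add (n : ℕ) (k : ℤ) (j : ℕ) (hj : j < S.m n) :
    S.seq n (k * S.m n + j) = S.W n (S.seq (n + 1) k) j := by
  have hm := S.m_pos n
  have hj' : (j : ℤ) < S.m n := by exact_mod_cast hj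
  rw [seq_eq, add_comm (k * _) (j : ℤ), Int.add_mul_ediv_right _ _ hm.ne',
    Int.ediv_eq_zero_of_lt (by positivity) hj', Int.add_mul_emod_self_right,
    Int.emod_eq_of_lt (by positivity) hj']
  simp

lemma seq_eq_α_iff (n : ℕ) (k : ℤ) : S.seq n k = S.α n ↔ (S.m n : ℤ) ∣ k := by
  have h1 := Int.emod_nonneg k (S.m_pos n).ne'
  have h2 := Int.emod_lt_of_pos k (S.m_pos n)
  rw [seq_eq, S.W_eq_α _ _ _ (by omega), Int.dvd_iff_emod_eq_zero]
  omega

lemma seq_eq_β (n : ℕ) (k : ℤ) : S.seq n (k * S.m n - 1) = S.β n := by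
  have := S.two_le n
  have h := S.seq_mul_add n (k - 1) (S.m n - 1) (by omega)
  rw [S.W_last] at h
  rw [← h]
  congr 1
  push_cast [show 1 ≤ S.m n by omega]
  ring

lemma exists_seq_eq (n : ℕ) (v : S.V n) : ∃ k, S.seq n k = v := by
  obtain ⟨j, hj, h⟩ := S.W_occ n (S.α (n + 1)) v
  exact ⟨(0 : ℤ) * S.m n + j, by
    rw [S.seq_mul_add n 0 j hj, (S.seq_eq_α_iff (n + 1) 0).2 (dvd_zero _), h]⟩

lemma seq_succ_eq_iff (n : ℕ) (k k' : ℤ) : S.seq (n + 1) k = S.seq (n + 1) k' ↔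
    ∀ j < S.m n, S.seq n (k * S.m n + j) = S.seq n (k' * S.m n + j) := by
  constructor
  · intro h j hj
    rw [S.seq_mul_add _ _ _ hj, S.seq_mul_add _ _ _ hj, h]
  · intro h
    refine S.W_inj n _ _ fun j hj => ?_
    rw [← S.seq_mul_add _ _ _ hj, ← S.seq_mul_add _ _ _ hj, h j hj]

/-- Splitting an index of a block of level `n + 1` into an index of a subblock and a position
inside it. -/
lemma block_index (n : ℕ) (k : ℤ) (i j : ℕ) :
    (k * S.m n + i) * S.q n + j = k * S.q (n + 1) + (i * S.q n + j : ℕ) := by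
  rw [q_succ]; push_cast; ring

lemma sub_block_lt {n i j : ℕ} (hi : i < S.m n) (hj : j < S.q n) :
    i * S.q n + j < S.q (n + 1) := by
  rw [q_succ]; nlinarith

lemma seq_eq_iff (n : ℕ) (k k' : ℤ) : S.seq n k = S.seq n k' ↔
    ∀ j < S.q n, S.seq 0 (k * S.q n + j) = S.seq 0 (k' * S.q n + j) := by
  induction n generalizing k k' with
  | zero => simp
  | succ n ih =>
    rw [seq_succ_eq_iff]
    have hq : 0 < S.q n := by exact_mod_cast S.q_pos n
    constructor
    · intro h j hj
      have h1 := (ih _ _).1 (h (j / S.q n) (by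
        rw [Nat.div_lt_iff_lt_mul hq]; rwa [q_succ, mul_comm] at hj)) (j % S.q n)
        (Nat.mod_lt _ hq)
      rwa [block_index, block_index, Nat.div_add_mod'] at h1
    · intro h i hi
      refine (ih _ _).2 fun j hj => ?_
      rw [block_index, block_index]
      exact h _ (S.sub_block_lt hi hj)

lemma isToeplitz : IsToeplitz (S.seq 0) := by
  intro k
  refine ⟨S.q (k.natAbs + 1), by have := S.q_pos (k.natAbs + 1); omega, fun t => ?_⟩
  have hlt := S.lt_q k.natAbs
  obtain ⟨n, hn⟩ : ∃ n, n = k.natAbs := ⟨_, rfl⟩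
  rw [← hn] at hlt ⊢
  have key : ∀ a : ℤ, a = 0 ∨ a = -1 → S.seq n (a + t * S.m n) = S.seq n a := by
    rintro a (rfl | rfl)
    · rw [(S.seq_eq_α_iff n _).2, (S.seq_eq_α_iff n _).2] <;> simp
    · have h1 := S.seq_eq_β n t
      have h2 := S.seq_eq_β n 0
      rw [zero_mul, zero_sub] at h2
      rw [h2, ← h1]
      congr 1
      ring
  obtain ⟨a, j, ha, hj, rfl⟩ : ∃ (a : ℤ) (j : ℕ), (a = 0 ∨ a = -1) ∧ j < S.q n ∧
      k = a * S.q n + j := by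
    rcases le_or_gt 0 k with h | h
    · exact ⟨0, n, Or.inl rfl, hlt, by omega⟩
    · exact ⟨-1, S.q n - n, Or.inr rfl, by omega, by omega⟩
  have := (S.seq_eq_iff n _ _).1 (key a ha) j hj
  rw [← this, q_succ]
  congr 1
  push_cast
  ring

/-- `F` is determined by a bounded window of the sequence of level `0`. -/
def IsLocal {A : Type} (F : ℤ → A) : Prop :=
  ∃ N : ℕ, ∀ k k' : ℤ, (∀ j : ℤ, |j| ≤ N → S.seq 0 (k + j) = S.seq 0 (k' + j)) → F k = F k'

lemma isLocal_block (n : ℕ) :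
    S.IsLocal fun k => (k % S.q n, S.seq n (k / S.q n)) := by
  induction n with
  | zero => exact ⟨0, fun k k' h => by simpa using h 0 (by simp)⟩
  | succ n ih =>
    obtain ⟨N, hN⟩ := ih
    refine ⟨N + S.q n * S.m n, fun k k' h => ?_⟩
    have hq := S.q_pos n
    have hm := S.m_pos n
    have h1 : ∀ j : ℤ, |j| ≤ S.q n * S.m n →
        (k + j) % S.q n = (k' + j) % S.q n ∧
        S.seq n ((k + j) / S.q n) = S.seq n ((k' + j) / S.q n) := by
      intro j hj
      refine Prod.ext_iff.1 (hN (k + j) (k' + j) fun i hi => ?_)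
      rw [add_assoc, add_assoc]
      refine h _ ((abs_add_le _ _).trans ?_)
      push_cast
      linarith
    have h0 := (h1 0 (by simp; positivity)).1
    rw [add_zero, add_zero] at h0
    set a := k / S.q n with ha
    set a' := k' / S.q n with ha'
    have h2 : ∀ i : ℤ, |i| ≤ S.m n → S.seq n (a + i) = S.seq n (a' + i) := by
      intro i hi
      have := (h1 (i * S.q n) (by
        rw [abs_mul, Nat.abs_cast, mul_comm]
        exact mul_le_mul_of_nonneg_left hi hq.le)).2
      rwa [Int.add_mul_ediv_right _ _ hq.ne', Int.add_mul_ediv_right _ _ hq.ne'] at this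
    have hr := Int.emod_nonneg a hm.ne'
    have hr' := Int.emod_lt_of_pos a hm
    have h3 : a % S.m n = a' % S.m n := by
      have h4 := h2 (-(a % S.m n)) (by rw [abs_neg, abs_of_nonneg hr]; exact hr'.le)
      have h5 : S.seq n (a + -(a % S.m n)) = S.α n :=
        (S.seq_eq_α_iff n _).2 (by rw [← sub_eq_add_neg]; exact Int.dvd_self_sub_emod)
      rw [h5, eq_comm, seq_eq_α_iff, ← sub_eq_add_neg] at h4
      exact ((Int.emod_eq_emod_iff_emod_sub_eq_zero.2 (Int.emod_eq_zero_of_dvd h4)).trans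
        (Int.emod_emod_of_dvd a dvd_rfl)).symm
    have hb : S.seq (n + 1) (a / S.m n) = S.seq (n + 1) (a' / S.m n) := by
      refine (S.seq_succ_eq_iff n _ _).2 fun j hj => ?_
      have e1 : a / S.m n * S.m n + j = a + (j - a % S.m n) := by
        have := Int.ediv_mul_add_emod a (S.m n); linarith
      have e2 : a' / S.m n * S.m n + j = a' + (j - a % S.m n) := by
        have := Int.ediv_mul_add_emod a' (S.m n); rw [h3]; linarith
      rw [e1, e2]
      refine h2 _ ?_
      rw [abs_le]
      constructor <;> omega
    have hdiv : ∀ x : ℤ, x / S.q (n + 1) = x / S.q n / S.m n := fun x => by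
      rw [q_succ, Nat.cast_mul, Int.ediv_ediv_of_nonneg hq.le]
    refine Prod.ext ?_ ?_
    · simp only [Int.emod_def _ (S.q (n + 1) : ℤ), hdiv, ← ha, ← ha']
      rw [q_succ]
      push_cast
      have e1 := Int.ediv_mul_add_emod a (S.m n)
      have e2 := Int.ediv_mul_add_emod a' (S.m n)
      have e3 := Int.ediv_mul_add_emod k (S.q n)
      have e4 := Int.ediv_mul_add_emod k' (S.q n)
      rw [← ha] at e3
      rw [← ha'] at e4
      have e5 : k - a * S.q n = k' - a' * S.q n := by linarith
      have e6 : a - a / S.m n * S.m n = a' - a' / S.m n * S.m n := by linarith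
      linear_combination e5 + S.q n * e6
    · simp only [hdiv]
      exact hb

lemma isNonperiodic : IsNonperiodic (S.seq 0) := by
  rintro ⟨p, hp, h⟩
  obtain ⟨N, hN⟩ := S.isLocal_block p.natAbs
  have h1 := congrArg Prod.fst (hN 0 (0 + p) fun j _ => by
    rw [show 0 + p + j = 0 + j + p by ring, h])
  have := S.lt_q p.natAbs
  simp only [zero_add, Int.zero_emod] at h1
  rw [Int.emod_eq_of_lt (by omega) (by omega)] at h1
  omega

open Finset

/-- `F` is determined on a block of level `n` by the type of the block. -/
def IsBlockwise {A : Type} (n : ℕ) (F : ℤ → A) : Prop :=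
  ∀ k k' : ℤ, S.seq n k = S.seq n k' → ∀ j < S.q n, F (k * S.q n + j) = F (k' * S.q n + j)

variable {S}

lemma IsBlockwise.succ {A : Type} {n : ℕ} {F : ℤ → A} (h : S.IsBlockwise n F) :
    S.IsBlockwise (n + 1) F := by
  intro k k' hk j hj
  have hq : 0 < S.q n := by exact_mod_cast S.q_pos n
  have h1 := h _ _ ((S.seq_succ_eq_iff n k k').1 hk (j / S.q n) (by
    rw [Nat.div_lt_iff_lt_mul hq]; rwa [q_succ, mul_comm] at hj)) (j % S.q n) (Nat.mod_lt _ hq)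
  rwa [block_index, block_index, Nat.div_add_mod'] at h1

lemma IsBlockwise.mono {A : Type} {n n' : ℕ} {F : ℤ → A} (h : S.IsBlockwise n F) (hn : n ≤ n') :
    S.IsBlockwise n' F := by
  induction n', hn using Nat.le_induction with
  | base => exact h
  | succ n' _ ih => exact ih.succ

variable (S) in
lemma exists_block_index (n : ℕ) (k : ℤ) : ∃ j < S.q n, k = k / S.q n * S.q n + (j : ℕ) := by
  have h1 := Int.emod_nonneg k (S.q_pos n).ne'
  have h2 := Int.emod_lt_of_pos k (S.q_pos n)
  have h3 := Int.ediv_mul_add_emod k (S.q n)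
  exact ⟨(k % S.q n).toNat, by omega, by omega⟩

variable (S) in
lemma block_ediv (n : ℕ) (k : ℤ) {j : ℕ} (hj : j < S.q n) : (k * S.q n + j) / S.q n = k := by
  rw [add_comm, Int.add_mul_ediv_right _ _ (S.q_pos n).ne',
    Int.ediv_eq_zero_of_lt (by positivity) (by exact_mod_cast hj), zero_add]

variable (S) in
lemma block_emod (n : ℕ) (k : ℤ) {j : ℕ} (hj : j < S.q n) : (k * S.q n + j) % S.q n = j := by
  rw [add_comm, Int.add_mul_emod_self_right,
    Int.emod_eq_of_lt (by positivity) (by exact_mod_cast hj)]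

lemma IsLocal.isBlockwise {A : Type} {F : ℤ → A} (h : S.IsLocal F) : ∃ n, S.IsBlockwise n F := by
  obtain ⟨N, hN⟩ := h
  refine ⟨N + 1, fun k k' hk j hj => hN _ _ fun i hi => ?_⟩
  have hlt := S.lt_q N
  have hm := S.two_le N
  set x : ℤ := j + i with hx
  have hj' : (j : ℤ) < S.m N * S.q N := by
    rw [q_succ] at hj
    rw [mul_comm]
    exact_mod_cast hj
  obtain ⟨r, hr, hxr⟩ := S.exists_block_index N x
  set a := x / S.q N
  have ha1 : -1 ≤ a := by
    rw [Int.le_ediv_iff_mul_le (S.q_pos N)]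
    have := (abs_le.1 hi).1
    omega
  have ha2 : a ≤ S.m N := by
    rw [← Int.lt_add_one_iff, Int.ediv_lt_iff_lt_mul (S.q_pos N), add_mul]
    have := (abs_le.1 hi).2
    omega
  have hseq : S.seq N (k * S.m N + a) = S.seq N (k' * S.m N + a) := by
    rcases eq_or_lt_of_le ha1 with h | h
    · rw [← h, ← sub_eq_add_neg, ← sub_eq_add_neg, seq_eq_β, seq_eq_β]
    rcases eq_or_lt_of_le ha2 with h' | h'
    · rw [h', (S.seq_eq_α_iff N _).2, (S.seq_eq_α_iff N _).2] <;>
      exact dvd_add (dvd_mul_left _ _) dvd_rfl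
    · lift a to ℕ using by omega with b
      exact (S.seq_succ_eq_iff N k k').1 hk b (by exact_mod_cast h')
  have h2 := (S.seq_eq_iff N _ _).1 hseq r hr
  rw [add_assoc, add_assoc, ← hx, hxr, q_succ]
  convert h2 using 2 <;> · push_cast; ring

lemma isLocal_of_block {A : Type} (n : ℕ) (f : ℤ → S.V n → A) :
    S.IsLocal fun k => f (k % S.q n) (S.seq n (k / S.q n)) := by
  obtain ⟨N, hN⟩ := S.isLocal_block n
  refine ⟨N, fun k k' h => ?_⟩
  have := Prod.ext_iff.1 (hN k k' h)
  simp only at this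
  simp only [this.1, this.2]

lemma isBlockwise_of_block {A : Type} (n : ℕ) (f : ℤ → S.V n → A) :
    S.IsBlockwise n fun k => f (k % S.q n) (S.seq n (k / S.q n)) := by
  intro k k' hk j hj
  simp only [S.block_ediv n _ hj, S.block_emod n _ hj, hk]

variable (S)

/-- A position of a block of level `n` with a given type. -/
noncomputable def occ (n : ℕ) (v : S.V n) : ℤ := (S.exists_seq_eq n v).choose

@[simp] lemma seq_occ (n : ℕ) (v : S.V n) : S.seq n (S.occ n v) = v :=
  (S.exists_seq_eq n v).choose_spec

/-- The sums of `F` over the blocks of level `n`. -/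
noncomputable def blockSum (n : ℕ) (F : ℤ → ℤ) (v : S.V n) : ℤ :=
  ∑ j ∈ range (S.q n), F (S.occ n v * S.q n + j)

/-- Pulling a function on the letters of level `n` back to letters of level `n + 1` by summing
along words. -/
def push (n : ℕ) (s : S.V n → ℤ) (v : S.V (n + 1)) : ℤ := ∑ i ∈ range (S.m n), s (S.W n v i)

variable {S}

lemma IsBlockwise.blockSum_seq {n : ℕ} {F : ℤ → ℤ} (h : S.IsBlockwise n F) (k : ℤ) :
    S.blockSum n F (S.seq n k) = ∑ j ∈ range (S.q n), F (k * S.q n + j) :=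
  sum_congr rfl fun j hj => h _ _ (S.seq_occ n _) j (mem_range.1 hj)

lemma IsBlockwise.blockSum_succ {n : ℕ} {F : ℤ → ℤ} (h : S.IsBlockwise n F) :
    S.blockSum (n + 1) F = S.push n (S.blockSum n F) := by
  have hsum : ∀ (f : ℕ → ℤ) (l : ℕ), ∑ j ∈ range (l * S.q n), f j =
      ∑ i ∈ range l, ∑ j ∈ range (S.q n), f (i * S.q n + j) := by
    intro f l
    induction l with
    | zero => simp
    | succ l ih => rw [add_mul, one_mul, sum_range_add, ih, sum_range_succ]
  funext v
  rw [push, blockSum, q_succ, mul_comm, hsum]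
  refine sum_congr rfl fun i hi => ?_
  have hw := S.seq_mul_add n (S.occ (n + 1) v) i (mem_range.1 hi)
  rw [seq_occ] at hw
  rw [← hw, h.blockSum_seq]
  refine sum_congr rfl fun j _ => ?_
  rw [block_index, q_succ, mul_comm (S.m n)]

/-- An inductive system of weights on the letters of a block system with values in `G`. -/
structure Weight (S : BlockSystem) (G : Type) [AddCommGroup G] where
  A : ∀ n, S.V n → G
  compat : ∀ n (s : S.V n → ℤ), ∑ v, s v • A n v = ∑ v, S.push n s v • A (n + 1) v
  kill : ∀ n (s : S.V n → ℤ), ∑ v, s v • A n v = 0 → S.push (n + 1) (S.push n s) = 0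

variable {G : Type} [AddCommGroup G] (w : S.Weight G)

/-- The total weight of `F` computed at level `n`. -/
noncomputable def Weight.value (n : ℕ) (F : ℤ → ℤ) : G := ∑ v, S.blockSum n F v • w.A n v

lemma Weight.value_eq {n n' : ℕ} {F : ℤ → ℤ} (h : S.IsBlockwise n F) (hn : n ≤ n') :
    w.value n' F = w.value n F := by
  induction n', hn using Nat.le_induction with
  | base => rfl
  | succ n' hn' ih => rw [← ih, value, value, (h.mono hn').blockSum_succ, ← w.compat]

open Classical in
/-- The total weight of a local function. -/
noncomputable def Weight.total (F : ℤ → ℤ) : G :=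
  if h : ∃ n, S.IsBlockwise n F then w.value h.choose F else 0

lemma Weight.total_eq {n : ℕ} {F : ℤ → ℤ} (h : S.IsBlockwise n F) : w.total F = w.value n F := by
  have h' : ∃ n, S.IsBlockwise n F := ⟨n, h⟩
  rw [total, dif_pos h', ← w.value_eq h'.choose_spec (le_max_left _ n),
    w.value_eq h (le_max_right _ _)]

lemma Weight.total_add {F F' : ℤ → ℤ} (h : S.IsLocal F) (h' : S.IsLocal F') :
    w.total (F + F') = w.total F + w.total F' := by
  obtain ⟨n, hn⟩ := h.isBlockwise
  obtain ⟨n', hn'⟩ := h'.isBlockwise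
  replace hn := hn.mono (le_max_left n n')
  replace hn' := hn'.mono (le_max_right n n')
  have : S.IsBlockwise (max n n') (F + F') := fun k k' hk j hj => by
    rw [Pi.add_apply, Pi.add_apply, hn k k' hk j hj, hn' k k' hk j hj]
  rw [w.total_eq hn, w.total_eq hn', w.total_eq this, value, value, value, ← sum_add_distrib]
  refine sum_congr rfl fun v _ => ?_
  rw [← add_smul, blockSum, blockSum, blockSum, ← sum_add_distrib]
  rfl

lemma Weight.total_eq_zero_of_coboundary {F g : ℤ → ℤ} (hF : S.IsLocal F) (hg : S.IsLocal g)
    (h : ∀ k, F k = g k - g (k - 1)) : w.total F = 0 := by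
  obtain ⟨n, hn⟩ := hF.isBlockwise
  obtain ⟨n', hn'⟩ := hg.isBlockwise
  replace hn := hn.mono (le_max_left n n')
  replace hn' := hn'.mono (le_max_right n n')
  set N := max n n'
  have hq := S.q_pos N
  have hq' := S.q_pos (N + 1)
  have hlast : ∀ k : ℤ, g (k * S.q (N + 1) - 1) = g (-1) := by
    intro k
    have h1 : ∀ k : ℤ, k * S.q (N + 1) - 1 = (k * S.m N - 1) * S.q N + (S.q N - 1 : ℕ) := by
      intro k
      rw [q_succ]
      push_cast [show 1 ≤ S.q N by omega]
      ring
    have h2 := hn' (k * S.m N - 1) (0 * S.m N - 1) (by rw [seq_eq_β, seq_eq_β]) (S.q N - 1)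
      (by omega)
    rw [← h1, ← h1] at h2
    simpa using h2
  have hzero : S.blockSum (N + 1) F = 0 := by
    funext v
    have htel : ∀ (x : ℤ) (l : ℕ), ∑ j ∈ range l, F (x + j) = g (x + l - 1) - g (x - 1) := by
      intro x l
      induction l with
      | zero => simp
      | succ l ih =>
        rw [sum_range_succ, ih, h]
        push_cast
        rw [show x + (l + 1) - 1 = x + (l : ℤ) by ring]
        ring
    rw [blockSum, htel, hlast, Pi.zero_apply, sub_eq_zero, ← hlast (S.occ (N + 1) v + 1)]
    congr 1
    ring
  rw [w.total_eq hn.succ, value, hzero]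
  simp

lemma Weight.exists_coboundary_of_total_eq_zero {F : ℤ → ℤ} (hF : S.IsLocal F)
    (h : w.total F = 0) : ∃ g, S.IsLocal g ∧ ∀ k, F k = g k - g (k - 1) := by
  obtain ⟨n, hn⟩ := hF.isBlockwise
  rw [w.total_eq hn] at h
  have hz : S.blockSum (n + 2) F = 0 := by
    rw [hn.succ.blockSum_succ, hn.blockSum_succ, w.kill n _ h]
  replace hn := hn.succ.succ
  set N := n + 2
  have hq := S.q_pos N
  let f : ℤ → S.V N → ℤ := fun r v =>
    ∑ j ∈ range (r.toNat + 1), F (S.occ N v * S.q N + j)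
  refine ⟨_, isLocal_of_block N f, fun k => ?_⟩
  have hf : ∀ (a : ℤ) (j : ℕ), j < S.q N → f ((a * S.q N + j) % S.q N)
      (S.seq N ((a * S.q N + j) / S.q N)) = ∑ i ∈ range (j + 1), F (a * S.q N + i) := by
    intro a j hj
    rw [S.block_ediv N a hj, S.block_emod N a hj]
    refine sum_congr rfl fun i hi => hn _ _ (S.seq_occ N _) i ?_
    simp at hi
    omega
  obtain ⟨a, j, hj, rfl⟩ : ∃ (a : ℤ) (j : ℕ), j < S.q N ∧ k = a * S.q N + j :=
    ⟨_, S.exists_block_index N k⟩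
  rw [hf a j hj]
  rcases j with _ | j
  · have h1 : a * S.q N + (0 : ℕ) - 1 = (a - 1) * S.q N + (S.q N - 1 : ℕ) := by
      push_cast [show 1 ≤ S.q N by omega]
      ring
    have h2 := hn.blockSum_seq (a - 1)
    rw [hz] at h2
    rw [h1, hf (a - 1) _ (by omega), show S.q N - 1 + 1 = S.q N by omega, ← h2]
    simp
  · have h1 : a * S.q N + (j + 1 : ℕ) - 1 = a * S.q N + j := by push_cast; ring
    rw [h1, hf a j (by omega), sum_range_succ _ (j + 1)]
    ring

lemma Weight.exists_total_eq (n : ℕ) (c : S.V n → ℕ) :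
    ∃ F : ℤ → ℤ, S.IsLocal F ∧ (∀ k, 0 ≤ F k) ∧ w.total F = ∑ v, c v • w.A n v := by
  let f : ℤ → S.V n → ℤ := fun r v => if r = 0 then c v else 0
  refine ⟨_, isLocal_of_block n f, fun k => ?_, ?_⟩
  · simp only [f]; split_ifs <;> simp
  · rw [w.total_eq (isBlockwise_of_block n f), value]
    refine sum_congr rfl fun v _ => ?_
    rw [← natCast_zsmul]
    congr 1
    rw [blockSum, sum_eq_single_of_mem 0 (by have := S.q_pos n; simp; omega)]
    · simp [f, Int.mul_ediv_cancel _ (S.q_pos n).ne']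
    · intro j hj hj0
      simp only [f, S.block_emod n _ (mem_range.1 hj)]
      simp [hj0]

end BlockSystem

namespace ToeplitzFlow

open Filter Topology Uniformity

variable (F : ToeplitzFlow)

/-- The points of the orbit of the defining sequence. -/
def orbitPoint (k : ℤ) : F.X := ⟨fun j => F.η (j + k), subset_closure ⟨k, rfl⟩⟩

lemma T_orbitPoint (k : ℤ) : F.T (F.orbitPoint k) = F.orbitPoint (k + 1) := by
  refine Subtype.ext (funext fun j => ?_)
  change F.η (j + 1 + k) = F.η (j + (k + 1))
  congr 1
  ring

lemma T_symm_orbitPoint (k : ℤ) : F.T.symm (F.orbitPoint k) = F.orbitPoint (k - 1) := by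
  rw [Homeomorph.symm_apply_eq, T_orbitPoint, sub_add_cancel]

lemma denseRange_orbitPoint : DenseRange F.orbitPoint := by
  intro x
  rw [closure_subtype]
  have : Subtype.val '' Set.range F.orbitPoint = shiftOrbit F.η := by
    ext y
    constructor
    · rintro ⟨_, ⟨k, rfl⟩, rfl⟩
      exact ⟨k, rfl⟩
    · rintro ⟨k, rfl⟩
      exact ⟨_, ⟨k, rfl⟩, rfl⟩
  rw [this]
  exact x.2

instance : CompactSpace F.X :=
  isCompact_iff_compactSpace.1 (isClosed_closure.isCompact)

/-- The pairs of points agreeing on the window `[-N, N]`. -/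
def window (N : ℕ) : SetRel F.X F.X := {p | ∀ j : ℤ, |j| ≤ N → p.1.1 j = p.2.1 j}

lemma window_anti : Antitone F.window := fun _ _ h _ hp j hj =>
  hp j (hj.trans (by exact_mod_cast h))

lemma hasBasis_uniformity : (𝓤 F.X).HasBasis (fun _ : ℕ => True) F.window := by
  have h : 𝓤 F.X = ⨅ N, 𝓟 (F.window N) := by
    have h0 : 𝓤 F.X = ⨅ i : ℤ, 𝓟 {p : F.X × F.X | p.1.1 i = p.2.1 i} := by
      rw [uniformity_subtype, Pi.uniformity, comap_iInf]
      refine iInf_congr fun i => ?_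
      rw [comap_comap]
      have : 𝓤 F.Λ = 𝓟 {p : F.Λ × F.Λ | p.1 = p.2} := rfl
      rw [this, comap_principal]
      rfl
    rw [h0]
    refine le_antisymm (le_iInf fun N => ?_) (le_iInf fun i => ?_)
    · rw [le_principal_iff]
      have : F.window N = ⋂ i ∈ Finset.Icc (-(N : ℤ)) N, {p : F.X × F.X | p.1.1 i = p.2.1 i} := by
        ext p
        simp [window, abs_le]
      rw [this, Finset.iInter_mem_sets]
      exact fun i _ => mem_iInf_of_mem i (mem_principal_self _)
    · refine (iInf_le _ i.natAbs).trans (principal_mono.2 fun p hp => hp i ?_)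
      rw [Int.abs_eq_natAbs]
  rw [h]
  exact hasBasis_iInf_principal F.window_anti.directed_ge

lemma exists_orbitPoint_window (N : ℕ) (x : F.X) :
    ∃ k, ∀ j : ℤ, |j| ≤ N → F.η (j + k) = x.1 j := by
  obtain ⟨_, ⟨k, rfl⟩, hk⟩ := F.denseRange_orbitPoint.inter_nhds_nonempty
    (UniformSpace.ball_mem_nhds x (F.hasBasis_uniformity.mem_of_mem (i := N) trivial))
  exact ⟨k, fun j hj => (hk j hj).symm⟩

end ToeplitzFlow

namespace BlockSystem

variable (S : BlockSystem)

/-- The Toeplitz flow of a block system. -/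
def flow : ToeplitzFlow where
  Λ := S.V 0
  nonempty := ⟨S.α 0⟩
  η := S.seq 0
  toeplitz := S.isToeplitz
  nonperiodic := S.isNonperiodic

lemma isLocal_comp_orbitPoint (f : C(S.flow.X, ℤ)) :
    S.IsLocal fun k => f (S.flow.orbitPoint k) := by
  have hf : UniformContinuous f := CompactSpace.uniformContinuous_of_continuous f.continuous
  have h1 : {p : ℤ × ℤ | dist p.1 p.2 < 1} ∈ uniformity ℤ := Metric.dist_mem_uniformity one_pos
  obtain ⟨N, -, hN⟩ := S.flow.hasBasis_uniformity.mem_iff.1 (hf h1)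
  refine ⟨N, fun k k' h => ?_⟩
  have h2 : dist (f (S.flow.orbitPoint k)) (f (S.flow.orbitPoint k')) < 1 :=
    hN (a := (S.flow.orbitPoint k, S.flow.orbitPoint k')) fun j hj => by
      change S.seq 0 (j + k) = S.seq 0 (j + k')
      rw [add_comm j, add_comm j, h j hj]
  rw [Int.dist_eq'] at h2
  exact sub_eq_zero.1 (Int.abs_lt_one_iff.1 (by exact_mod_cast h2))

lemma IsLocal.exists_extension {S : BlockSystem} {g : ℤ → ℤ} (hg : S.IsLocal g) :
    ∃ f : C(S.flow.X, ℤ), (∀ k, f (S.flow.orbitPoint k) = g k) ∧ ∀ x, ∃ k, f x = g k := by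
  obtain ⟨N, hN⟩ := hg
  choose κ hκ using S.flow.exists_orbitPoint_window N
  have hg : ∀ k k', (∀ j : ℤ, |j| ≤ N → S.flow.η (j + k) = S.flow.η (j + k')) → g k = g k' :=
    fun k k' h => hN k k' fun j hj => by rw [add_comm k, add_comm k']; exact h j hj
  have hc : IsLocallyConstant fun x => g (κ x) := by
    rw [IsLocallyConstant.iff_eventually_eq]
    intro x
    filter_upwards [UniformSpace.ball_mem_nhds x
      (S.flow.hasBasis_uniformity.mem_of_mem (i := N) trivial)] with y hy
    exact hg _ _ fun j hj => by rw [hκ y j hj, hκ x j hj]; exact (hy j hj).symm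
  exact ⟨⟨_, hc.continuous⟩, fun k => hg _ _ fun j hj => hκ _ j hj, fun x => ⟨κ x, rfl⟩⟩

variable {S} {G : Type} [AddCommGroup G] (w : S.Weight G)

/-- The homomorphism from continuous functions to `G` induced by a weight. -/
noncomputable def Weight.hom : C(S.flow.X, ℤ) →+ G :=
  AddMonoidHom.mk' (fun f => w.total fun k => f (S.flow.orbitPoint k)) fun f f' =>
    w.total_add (S.isLocal_comp_orbitPoint f) (S.isLocal_comp_orbitPoint f')

lemma Weight.ker_hom : w.hom.ker = coboundaries S.flow.T := by
  ext f
  rw [AddMonoidHom.mem_ker]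
  constructor
  · intro h
    obtain ⟨g, hg, hfg⟩ := w.exists_coboundary_of_total_eq_zero (S.isLocal_comp_orbitPoint f) h
    obtain ⟨g', hg', -⟩ := hg.exists_extension
    refine ⟨g', ContinuousMap.ext fun x => ?_⟩
    refine congrFun (S.flow.denseRange_orbitPoint.equalizer (ContinuousMap.continuous _)
      f.continuous (funext fun k => ?_)) x
    change g' (S.flow.orbitPoint k) - g' (S.flow.T.symm (S.flow.orbitPoint k)) =
      f (S.flow.orbitPoint k)
    rw [S.flow.T_symm_orbitPoint, hg', hg', hfg]
  · rintro ⟨g, rfl⟩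
    refine w.total_eq_zero_of_coboundary (S.isLocal_comp_orbitPoint _)
      (S.isLocal_comp_orbitPoint g) fun k => ?_
    change g (S.flow.orbitPoint k) - g (S.flow.T.symm (S.flow.orbitPoint k)) = _
    rw [S.flow.T_symm_orbitPoint]

/-- The image of the nonnegative functions is the cone generated by the weights. -/
lemma Weight.hom_image_nonneg :
    w.hom '' {f | ∀ x, 0 ≤ f x} = {g | ∃ (n : ℕ) (c : S.V n → ℕ), g = ∑ v, c v • w.A n v} := by
  ext g
  constructor
  · rintro ⟨f, hf, rfl⟩
    obtain ⟨n, hn⟩ := (S.isLocal_comp_orbitPoint f).isBlockwise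
    refine ⟨n, fun v => (S.blockSum n (fun k => f (S.flow.orbitPoint k)) v).toNat, ?_⟩
    change w.total _ = _
    rw [w.total_eq hn, value]
    refine Finset.sum_congr rfl fun v _ => ?_
    rw [← natCast_zsmul, Int.toNat_of_nonneg]
    exact Finset.sum_nonneg fun j _ => hf _
  · rintro ⟨n, c, rfl⟩
    obtain ⟨F, hF, hF0, hFw⟩ := w.exists_total_eq n c
    obtain ⟨f, hf, hf'⟩ := hF.exists_extension
    refine ⟨f, fun x => ?_, ?_⟩
    · obtain ⟨k, hk⟩ := hf' x
      rw [hk]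
      exact hF0 k
    · rw [← hFw]
      change w.total _ = _
      simp_rw [hf]

end BlockSystem

namespace ToeplitzFlow

open Filter Topology Uniformity Dynamics

variable (F : ToeplitzFlow)

lemma iterate_T_apply (i : ℕ) (x : F.X) (j : ℤ) : (F.T^[i] x).1 j = x.1 (j + i) := by
  induction i generalizing x with
  | zero => simp
  | succ i ih =>
    rw [Function.iterate_succ_apply, ih]
    change x.1 (j + i + 1) = _
    push_cast
    ring_nf

lemma mem_dynEntourage_window {N n : ℕ} {x y : F.X} :
    (x, y) ∈ dynEntourage F.T (F.window N) n ↔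
      ∀ i < n, ∀ j : ℤ, |j| ≤ N → x.1 (j + i) = y.1 (j + i) := by
  rw [mem_dynEntourage]
  refine forall₂_congr fun i _ => forall₂_congr fun j _ => ?_
  rw [iterate_T_apply, iterate_T_apply]

instance (N : ℕ) : (F.window N).IsSymm := ⟨fun _ _ h j hj => (h j hj).symm⟩

end ToeplitzFlow

namespace BlockSystem

open Filter Topology Dynamics

variable (S : BlockSystem)

/-- The position of `k` in its block of level `n`, together with the letters of level `n` in
`L + 3` consecutive blocks around `k`. -/
def code (n L : ℕ) (k : ℤ) : Fin (S.q n) × (Fin (L + 3) → S.V n) :=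
  (⟨(k % S.q n).toNat, by
    have := Int.emod_nonneg k (S.q_pos n).ne'
    have := Int.emod_lt_of_pos k (S.q_pos n)
    omega⟩, fun i => S.seq n (k / S.q n + i - 1))

lemma seq_eq_of_code_eq {n L N : ℕ} (hN : N ≤ S.q n) {k k' : ℤ}
    (h : S.code n L k = S.code n L k') {j : ℤ} (h1 : -(N : ℤ) ≤ j) (h2 : j ≤ L * S.q n + N) :
    S.seq 0 (j + k) = S.seq 0 (j + k') := by
  have hq := S.q_pos n
  have hN' : (N : ℤ) ≤ S.q n := by exact_mod_cast hN
  have hr := Int.emod_nonneg k hq.ne'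
  have hr' := Int.emod_nonneg k' hq.ne'
  have hl := Int.emod_lt_of_pos k hq
  have e := Int.ediv_mul_add_emod k (S.q n)
  have e' := Int.ediv_mul_add_emod k' (S.q n)
  have hkk : k % S.q n = k' % S.q n := by
    have := congrArg (fun c => (c.1 : ℕ)) h
    simp only [code] at this
    omega
  obtain ⟨l, hl', hx⟩ := S.exists_block_index n (j + k % S.q n)
  set a := (j + k % S.q n) / S.q n with ha
  have ha1 : -1 ≤ a := by
    rw [ha, Int.le_ediv_iff_mul_le hq]
    linarith
  have ha2 : a < L + 2 := by
    rw [ha, Int.ediv_lt_iff_lt_mul hq]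
    linarith
  have hc : S.seq n (k / S.q n + a) = S.seq n (k' / S.q n + a) := by
    have := congrFun (congrArg Prod.snd h) ⟨(a + 1).toNat, by omega⟩
    simp only [code] at this
    rw [Int.toNat_of_nonneg (by omega)] at this
    convert this using 2 <;> ring
  have := (S.seq_eq_iff n _ _).1 hc l hl'
  convert this using 2
  · linear_combination hx + (-1 : ℤ) * e
  · linear_combination hx + (-1 : ℤ) * e' - hkk

lemma exists_isDynCoverOf {n L N : ℕ} (hN : N ≤ S.q n) :
    ∃ s : Finset S.flow.X, IsDynCoverOf S.flow.T Set.univ (S.flow.window N) (L * S.q n) s ∧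
      s.card ≤ S.q n * Fintype.card (S.V n) ^ (L + 3) := by
  classical
  let κ : Fin (S.q n) × (Fin (L + 3) → S.V n) → ℤ := Function.invFun (S.code n L)
  refine ⟨Finset.univ.image fun c => S.flow.orbitPoint (κ c), fun x _ => ?_, ?_⟩
  · obtain ⟨k, hk⟩ := S.flow.exists_orbitPoint_window (L * S.q n + N) x
    refine ⟨_, Finset.mem_coe.2 (Finset.mem_image_of_mem _ (Finset.mem_univ (S.code n L k))), ?_⟩
    rw [ToeplitzFlow.mem_dynEntourage_window]
    intro i hi j hj
    rw [abs_le] at hj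
    have hi' : (i : ℤ) < L * S.q n := by exact_mod_cast hi
    rw [← hk _ (by push_cast; rw [abs_le]; constructor <;> linarith)]
    exact (S.seq_eq_of_code_eq hN (Function.invFun_eq ⟨k, rfl⟩) (by linarith) (by linarith)).symm
  · refine Finset.card_image_le.trans (le_of_eq ?_)
    simp

lemma card_le_coverMincard (n : ℕ) :
    (Fintype.card (S.V n) : ℕ∞) ≤
      coverMincard S.flow.T Set.univ (S.flow.window 0) (S.q n) := by
  classical
  have key : ∀ v v' : S.V n, ∀ z, (S.flow.orbitPoint (S.occ n v * S.q n), z) ∈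
      dynEntourage S.flow.T (S.flow.window 0) (S.q n) →
      (S.flow.orbitPoint (S.occ n v' * S.q n), z) ∈
      dynEntourage S.flow.T (S.flow.window 0) (S.q n) → v = v' := by
    intro v v' z h h'
    rw [ToeplitzFlow.mem_dynEntourage_window] at h h'
    rw [← S.seq_occ n v, ← S.seq_occ n v', S.seq_eq_iff]
    intro j hj
    have := (h j hj 0 (by simp)).trans (h' j hj 0 (by simp)).symm
    change S.seq 0 (0 + j + _) = S.seq 0 (0 + j + _) at this
    rwa [zero_add, add_comm, add_comm (j : ℤ)] at this
  have hinj : Function.Injective fun v => S.flow.orbitPoint (S.occ n v * S.q n) := by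
    intro v v' h
    refine key v v' _ (ToeplitzFlow.mem_dynEntourage_window _ |>.2 fun _ _ _ _ => rfl) ?_
    rw [ToeplitzFlow.mem_dynEntourage_window]
    intro i _ j _
    simp only at h
    rw [h]
  rw [← Finset.card_univ, ← Finset.card_image_of_injective _ hinj]
  refine le_trans ?_ (netMaxcard_le_coverMincard _ _ _)
  refine IsDynNetIn.card_le_netMaxcard ⟨Set.subset_univ _, ?_⟩
  rintro _ hx _ hy hne
  simp only [Finset.coe_image, Finset.coe_univ, Set.image_univ, Set.mem_range] at hx hy
  obtain ⟨v, rfl⟩ := hx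
  obtain ⟨v', rfl⟩ := hy
  refine Set.disjoint_left.2 fun z hz hz' => hne ?_
  rw [key v v' z hz hz']

variable {S} {t : ℝ}

lemma le_entropy (h : ∀ n, Real.exp (t * S.q n) ≤ Fintype.card (S.V n)) :
    (t : EReal) ≤ S.flow.entropy := by
  refine le_trans ?_ (coverEntropyEntourage_le_coverEntropy _ _
    (S.flow.hasBasis_uniformity.mem_of_mem (i := 0) trivial))
  refine Filter.le_limsup_of_frequently_le' ?_
  have hq : Tendsto S.q atTop atTop := tendsto_atTop_mono (fun n => (S.lt_q n).le) tendsto_id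
  refine hq.frequently (Eventually.frequently (Eventually.of_forall fun n => ?_))
  have hq0 : (0 : ℝ) < S.q n := by exact_mod_cast S.q_pos n
  rw [EReal.le_div_iff_mul_le (by exact_mod_cast hq0) (EReal.natCast_ne_top _)]
  calc (t : EReal) * (S.q n : EReal) = ((t * S.q n : ℝ) : EReal) := by push_cast; rfl
    _ = ENNReal.log (ENNReal.ofReal (Real.exp (t * S.q n))) := by
      rw [ENNReal.log_ofReal_of_pos (Real.exp_pos _), Real.log_exp]
    _ ≤ ENNReal.log (Fintype.card (S.V n)) := by
      refine ENNReal.log_monotone (ENNReal.ofReal_le_of_le_toReal ?_)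
      simpa using h n
    _ ≤ _ := by
      refine ENNReal.log_monotone ?_
      have := ENat.toENNReal_mono (S.card_le_coverMincard n)
      simpa using this

lemma entropy_le
    (h : Tendsto (fun n => Real.log (Fintype.card (S.V n)) / S.q n) atTop (𝓝 t)) :
    S.flow.entropy ≤ t := by
  refine iSup₂_le fun U hU => ?_
  obtain ⟨N, -, hN⟩ := S.flow.hasBasis_uniformity.mem_iff.1 hU
  refine (coverEntropyEntourage_antitone _ _ hN).trans ?_
  refine (coverEntropyEntourage_antitone _ _ (?_ :
    SetRel.comp (S.flow.window N) (S.flow.window N) ⊆ S.flow.window N)).trans ?_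
  · rintro p ⟨z, h1, h2⟩ j hj
    exact (h1 j hj).trans (h2 j hj)
  have hq : Tendsto (fun n => (S.q n : ℝ)) atTop atTop :=
    tendsto_natCast_atTop_atTop.comp
      (tendsto_atTop_mono (fun n => (S.lt_q n).le) tendsto_id)
  have hlim : Tendsto (fun n : ℕ => Real.log (S.q n) / S.q n * (n : ℝ)⁻¹ +
      (1 + 3 * (n : ℝ)⁻¹) * (Real.log (Fintype.card (S.V n)) / S.q n)) atTop (𝓝 t) := by
    have h1 : Tendsto (fun n => Real.log (S.q n) / S.q n) atTop (𝓝 0) := by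
      have := (Real.isLittleO_log_id_atTop.tendsto_div_nhds_zero).comp hq
      exact this
    have h2 : Tendsto (fun n : ℕ => (n : ℝ)⁻¹) atTop (𝓝 0) := tendsto_inv_atTop_nhds_zero_nat
    have := (h1.mul h2).add ((tendsto_const_nhds (x := (1 : ℝ)).add (h2.const_mul 3)).mul h)
    simpa using this
  refine ge_of_tendsto ((continuous_coe_real_ereal.tendsto t).comp hlim) ?_
  filter_upwards [eventually_ge_atTop (N + 1)] with n hn
  obtain ⟨s, hs, hcard⟩ := S.exists_isDynCoverOf (n := n) (L := n) (N := N)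
    ((by omega : N ≤ n).trans (S.lt_q n).le)
  have hq0 : (0 : ℝ) < S.q n := by exact_mod_cast S.q_pos n
  have hn0 : (0 : ℝ) < n := by exact_mod_cast (by omega : 0 < n)
  have hV : (0 : ℝ) < Fintype.card (S.V n) := by
    exact_mod_cast Fintype.card_pos_iff.2 ⟨S.α n⟩
  refine (hs.coverEntropyEntourage_le_log_card_div (Set.mapsTo_univ _ _)
    (Nat.mul_ne_zero (by omega) (by exact_mod_cast hq0.ne'))).trans ?_
  rw [EReal.div_le_iff_le_mul (by exact_mod_cast mul_pos hn0 hq0) (EReal.natCast_ne_top _)]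
  calc ENNReal.log (s.card : ENNReal)
      ≤ ENNReal.log (ENNReal.ofReal (S.q n * Fintype.card (S.V n) ^ (n + 3) : ℝ)) := by
        refine ENNReal.log_monotone ?_
        rw [← ENNReal.ofReal_natCast]
        exact ENNReal.ofReal_le_ofReal (by exact_mod_cast hcard)
    _ = ((Real.log (S.q n) + (n + 3) * Real.log (Fintype.card (S.V n)) : ℝ) : EReal) := by
        rw [ENNReal.log_ofReal_of_pos (by positivity), Real.log_mul hq0.ne' (by positivity),
          Real.log_pow]
        push_cast
        rfl
    _ = (((n * S.q n : ℕ) : ℝ) * (Real.log (S.q n) / S.q n * (n : ℝ)⁻¹ +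
      (1 + 3 * (n : ℝ)⁻¹) * (Real.log (Fintype.card (S.V n)) / S.q n)) : ℝ) := by
        congr 1
        push_cast
        field_simp
    _ = _ := by rw [EReal.coe_mul]; rfl

end BlockSystem

section Levels

open Finset

lemma ceil_exp_add_two_le {x : ℝ} (hx : 0 ≤ x) :
    (⌈Real.exp x⌉₊ : ℝ) + 2 ≤ Real.exp (Real.log 4 + x) := by
  have h1 := (Nat.ceil_lt_add_one (Real.exp_pos x).le).le
  have h2 : (1 : ℝ) ≤ Real.exp x := Real.one_le_exp hx
  rw [Real.exp_add, Real.exp_log (by norm_num)]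
  linarith

lemma exists_word_threshold (q l : ℕ) (hq : 0 < q) {τ τ' : ℝ} (h0 : 0 ≤ τ') (h : τ' < τ) :
    ∃ ε > 0, ε ≤ q * (τ - τ') ∧ ∃ m₀ : ℕ, ∀ m ≥ m₀, ∀ l' : ℕ, (l' : ℝ) ≤ Real.exp (ε * m) →
      l' * (⌈Real.exp (τ' * (q * m : ℕ))⌉₊ + 2) * (m + 1) ^ (l * (⌈Real.exp (τ * q)⌉₊ + 2)) ≤
        (⌈Real.exp (τ * q)⌉₊ + 1) ^ (m - l * (⌈Real.exp (τ * q)⌉₊ + 2) - 1) := by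
  have hq' : (0 : ℝ) < q := by exact_mod_cast hq
  set δ := q * (τ - τ') with hδ
  have hδ0 : 0 < δ := mul_pos hq' (sub_pos.2 h)
  set k := l * (⌈Real.exp (τ * q)⌉₊ + 2) with hk
  obtain ⟨m₁, hm₁⟩ := Filter.eventually_atTop.1
    (eventually_pow_le_exp k (by positivity : 0 < δ / 4))
  obtain ⟨m₂, hm₂⟩ := exists_nat_ge ((Real.log 4 + τ * q * (k + 1)) / (δ / 2))
  refine ⟨δ / 4, by positivity, by linarith, max m₁ m₂, fun m hm l' hl' => ?_⟩
  have h1 := hm₁ m ((le_max_left _ _).trans hm)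
  have h2 : Real.log 4 + τ * q * (k + 1) ≤ m * (δ / 2) := by
    rw [div_le_iff₀ (by positivity)] at hm₂
    refine hm₂.trans ?_
    gcongr
    exact (le_max_right _ _).trans hm
  have h3 : (⌈Real.exp (τ' * (q * m : ℕ))⌉₊ : ℝ) + 2 ≤ Real.exp (Real.log 4 + τ' * (q * m)) := by
    have := ceil_exp_add_two_le (x := τ' * (q * m : ℕ)) (by positivity)
    rwa [Nat.cast_mul] at this ⊢
  have h4 : Real.exp (τ * q * (m - k - 1)) ≤
      ((⌈Real.exp (τ * q)⌉₊ + 1 : ℕ) : ℝ) ^ (m - k - 1) := by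
    have e1 := Nat.le_ceil (Real.exp (τ * q))
    have e2 : (m : ℝ) - k - 1 ≤ (m - k - 1 : ℕ) := by
      rw [sub_sub, Nat.sub_sub, sub_le_iff_le_add]
      exact_mod_cast (by omega : m ≤ m - (k + 1) + (k + 1))
    have hτ : 0 ≤ τ := h0.trans h.le
    calc Real.exp (τ * q * (m - k - 1)) ≤ Real.exp (τ * q * (m - k - 1 : ℕ)) := by gcongr
      _ = Real.exp (τ * q) ^ (m - k - 1) := by rw [← Real.exp_nat_mul, mul_comm]
      _ ≤ _ := by gcongr; push_cast; linarith
  have : ((l' * (⌈Real.exp (τ' * (q * m : ℕ))⌉₊ + 2) * (m + 1) ^ k : ℕ) : ℝ) ≤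
      ((⌈Real.exp (τ * q)⌉₊ + 1) ^ (m - k - 1) : ℕ) := by
    push_cast at h3 h4 ⊢
    calc _ ≤ Real.exp (δ / 4 * m) * Real.exp (Real.log 4 + τ' * (q * m)) *
          Real.exp (δ / 4 * m) := by gcongr
      _ = Real.exp (δ / 4 * m + (Real.log 4 + τ' * (q * m)) + δ / 4 * m) := by
        rw [← Real.exp_add, ← Real.exp_add]
      _ ≤ Real.exp (τ * q * (m - k - 1)) := by
        gcongr
        rw [hδ] at h2 ⊢
        nlinarith
      _ ≤ _ := h4
  exact_mod_cast this

variable {G : Type} [AddCommGroup G] [PartialOrder G]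

/-- A step between stages yields a substitution on coloured letters. -/
lemma Stage.IsStep.exists_substitution {u g : G} {N k m : ℕ} {ε : ℝ} {s s' : Stage u}
    {y : s'.ι → s.ι → ℕ} (h : s.IsStep g (N + 3) k ε s' m y) (N' : ℕ) (i₀ : s.ι)
    (hC : Fintype.card s'.ι * (N' + 2) * (m + 1) ^ (Fintype.card s.ι * (N + 2)) ≤
      (N + 1) ^ (m - Fintype.card s.ι * (N + 2) - 1)) :
    ∃ (Y : s'.ι → s.ι × Fin (N + 2) → ℕ) (W : s'.ι × Fin (N' + 2) → ℕ → s.ι × Fin (N + 2)),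
      (∀ v j, j < m → (W v j = (i₀, 0) ↔ j = 0)) ∧ (∀ v, W v (m - 1) = (i₀, 1)) ∧
      (∀ v v', (∀ j < m, W v j = W v' j) → v = v') ∧ (∀ v x, ∃ j < m, W v j = x) ∧
      (∀ v (f : s.ι × Fin (N + 2) → ℤ), ∑ j ∈ range m, f (W v j) = ∑ x, Y v.1 x * f x) ∧
      ∀ r i, ∑ c, Y r (i, c) = y r i := by
  classical
  let C := Fintype.card (s'.ι × Fin (N' + 2))
  have hrow : ∀ z : s.ι → ℕ, ∃ (Y : s.ι × Fin (N + 2) → ℕ)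
      (w : Fin C → Fin m → s.ι × Fin (N + 2)), (∃ r, y r = z) → Function.Injective w ∧
      (∀ c v, #{j | w c j = v} = Y v) ∧ (∀ i, ∑ s, Y (i, s) = z i) ∧
      (∀ c (j : Fin m), w c j = (i₀, 0) ↔ (j : ℕ) = 0) ∧
      (∀ c (j : Fin m), (j : ℕ) + 1 = m → w c j = (i₀, 1)) ∧ ∀ c v, ∃ j, w c j = v := by
    intro z
    by_cases hz : ∃ r, y r = z
    · obtain ⟨r, rfl⟩ := hz
      obtain ⟨Y, w, hw⟩ := exists_words i₀ N m C (y r) (h.le_entry r) (h.row_sum r)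
        (Fintype.card_pos_iff.2 ⟨(r, 0)⟩) (by simpa [C] using hC)
      exact ⟨Y, w, fun _ => hw⟩
    · exact ⟨0, fun _ _ => (i₀, 0), fun h => absurd h hz⟩
  choose Y w hw using hrow
  have hw' := fun r => hw (y r) ⟨r, rfl⟩
  let e := Fintype.equivFin (s'.ι × Fin (N' + 2))
  let W : s'.ι × Fin (N' + 2) → ℕ → s.ι × Fin (N + 2) := fun v j =>
    if hj : j < m then w (y v.1) (e v) ⟨j, hj⟩ else (i₀, 0)
  have hW : ∀ v (j : Fin m), W v j = w (y v.1) (e v) j := fun v j => dif_pos j.2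
  have hsum : ∀ v (f : s.ι × Fin (N + 2) → ℤ),
      ∑ j ∈ range m, f (W v j) = ∑ x, Y (y v.1) x * f x := by
    intro v f
    rw [← Fin.sum_univ_eq_sum_range fun j => f (W v j)]
    simp_rw [hW]
    rw [← sum_fiberwise univ (fun j => w (y v.1) (e v) j)]
    refine sum_congr rfl fun x _ => ?_
    rw [← (hw' v.1).2.1 (e v) x, sum_congr rfl fun j hj => by rw [(mem_filter.1 hj).2], sum_const,
      nsmul_eq_mul]
  have hm : ∀ v : s'.ι × Fin (N' + 2), 0 < m := by
    intro v
    rw [← h.row_sum v.1]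
    refine sum_pos (fun i _ => ?_) ⟨i₀, mem_univ _⟩
    have := h.le_entry v.1 i
    omega
  refine ⟨fun r => Y (y r), W, fun v j hj => ?_, fun v => ?_, fun v v' hv => ?_, fun v x => ?_,
    hsum, fun r => (hw' r).2.2.1⟩
  · exact hW v ⟨j, hj⟩ ▸ (hw' v.1).2.2.2.1 (e v) ⟨j, hj⟩
  · have := hm v
    exact (hW v ⟨m - 1, by omega⟩).trans ((hw' v.1).2.2.2.2.1 _ _ (by simp only; omega))
  · have hY : Y (y v.1) = Y (y v'.1) := by
      funext x
      have := (hsum v (Pi.single x 1)).symm.trans ((sum_congr rfl fun j hj => by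
        rw [hv j (mem_range.1 hj)]).trans (hsum v' (Pi.single x 1)))
      simpa [Pi.single_apply] using this
    have hy : y v.1 = y v'.1 := by
      funext i
      rw [← (hw' v.1).2.2.1 i, hY, (hw' v'.1).2.2.1 i]
    refine e.injective ((hw' v.1).1 (funext fun j => ?_))
    rw [← hW, hv j j.2, hW, hy]
  · obtain ⟨j, hj⟩ := (hw' v.1).2.2.2.2.2 (e v) x
    exact ⟨j, j.2, (hW v j).trans hj⟩

variable [IsOrderedAddMonoid G]

/-- A sequence of stages yields a block system with a weight. -/
lemma exists_weight_of_stages {u : G} (hu : u ≠ 0) (S : ℕ → Stage u) (m N k : ℕ → ℕ)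
    (ε : ℕ → ℝ) (g : ℕ → G) (y : ∀ n, (S (n + 1)).ι → (S n).ι → ℕ) (h0 : (S 0).q = 1)
    (h : ∀ n, (S n).IsStep (g n) (N n + 3) (k n) (ε n) (S (n + 1)) (m n) (y n))
    (hC : ∀ n, Fintype.card (S (n + 1)).ι * (N (n + 1) + 2) *
      (m n + 1) ^ (Fintype.card (S n).ι * (N n + 2)) ≤
      (N n + 1) ^ (m n - Fintype.card (S n).ι * (N n + 2) - 1)) :
    ∃ (B : BlockSystem) (w : B.Weight G), (∀ n, B.q n = (S n).q) ∧
      (∀ n, Fintype.card (B.V n) = Fintype.card (S n).ι * (N n + 2)) ∧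
      (∀ n v, 0 ≤ w.A n v) ∧ ∀ n, ∃ (n' : ℕ) (c : B.V n' → ℕ), g n = ∑ v, c v • w.A n' v := by
  let i₀ : ∀ n, (S n).ι := fun n => ((S n).nonempty hu).some
  choose Y W hα hβ hinj hocc hsum hY using fun n =>
    (h n).exists_substitution (N (n + 1)) (i₀ n) (hC n)
  have htwo : ∀ n, 2 ≤ m n := by
    intro n
    have h1 := (h n).row_sum (i₀ (n + 1))
    have h2 := (h n).le_entry (i₀ (n + 1)) (i₀ n)
    have h3 := single_le_sum (f := y n (i₀ (n + 1))) (fun _ _ => Nat.zero_le _) (mem_univ (i₀ n))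
    omega
  let B : BlockSystem :=
    { V := fun n => (S n).ι × Fin (N n + 2)
      m := m
      two_le := htwo
      W := W
      α := fun n => (i₀ n, 0)
      β := fun n => (i₀ n, 1)
      W_eq_α := hα
      W_last := hβ
      W_inj := hinj
      W_occ := hocc }
  let A : ∀ n, B.V n → G := fun n v => ∑ r, Y n r v • (S (n + 1)).a r
  have hA : ∀ n i, ∑ c, A n (i, c) = (S n).a i := by
    intro n i
    simp only [A]
    rw [sum_comm, (h n).refinement i]
    exact sum_congr rfl fun r _ => by rw [← sum_smul, hY]
  let f : ∀ n, (B.V n → ℤ) → (S (n + 1)).ι → ℤ := fun n s r => ∑ v, Y n r v * s v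
  have hpush : ∀ n s v, B.push n s v = f n s v.1 := fun n s v => hsum n v s
  have hval : ∀ n (s : B.V n → ℤ), ∑ v, s v • A n v = ∑ r, f n s r • (S (n + 1)).a r := by
    intro n s
    simp only [A, f, smul_sum, sum_smul]
    rw [sum_comm]
    refine sum_congr rfl fun r _ => sum_congr rfl fun v _ => ?_
    rw [mul_comm, mul_smul, natCast_zsmul]
  let w : B.Weight G :=
    { A := A
      compat := fun n s => by
        rw [hval]
        change _ = ∑ v : (S (n + 1)).ι × Fin (N (n + 1) + 2), _
        rw [Fintype.sum_prod_type]
        refine sum_congr rfl fun r _ => ?_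
        simp_rw [hpush]
        rw [← smul_sum, hA]
      kill := fun n s hs => by
        rw [hval] at hs
        funext v
        rw [hpush]
        change ∑ x : (S (n + 1)).ι × Fin (N (n + 1) + 2), _ = _
        rw [Fintype.sum_prod_type]
        refine Eq.trans (sum_congr rfl fun r _ => ?_) ((h (n + 1)).kill _ hs v.1)
        simp_rw [hpush]
        rw [← sum_mul, ← hY (n + 1) v.1 r]
        push_cast
        rfl }
  refine ⟨B, w, fun n => ?_, fun n => ?_, fun n v => ?_, fun n => ?_⟩
  · induction n with
    | zero => rw [h0, B.q_zero]
    | succ n ih => rw [B.q_succ, ih, (h n).q_eq]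
  · change Fintype.card ((S n).ι × Fin (N n + 2)) = _
    simp
  · exact sum_nonneg fun r _ => nsmul_nonneg ((S (n + 1)).pos r).le _
  · obtain ⟨γ, hγ⟩ := (h n).generates
    refine ⟨n + 1, fun v => γ v.1, ?_⟩
    rw [hγ]
    change _ = ∑ v : (S (n + 1)).ι × Fin (N (n + 1) + 2), _
    rw [Fintype.sum_prod_type]
    exact sum_congr rfl fun r _ => by rw [← hA (n + 1) r, smul_sum]

end Levels

section Realization

open Finset Filter Topology

variable {G : Type} [AddCommGroup G] [PartialOrder G] [IsOrderedAddMonoid G]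

/-- A dimension order with a divisible enough order unit is generated by a weight on a block
system of prescribed entropy. -/
lemma IsDimensionOrder.exists_weight (hG : IsDimensionOrder G)
    (hs : ∀ a : G, 0 < a → ∀ b, ∃ n : ℕ, b ≤ n • a) {u : G} (hu : 0 < u)
    (hdiv : ∀ (d : ℕ) (w : G), 0 < d → d • w = u → ∀ M : ℕ, ∃ e w', M ≤ e ∧ (d * e) • w' = u)
    (g : ℕ → G) (hg : ∀ n, 0 ≤ g n) {t : ℝ} (ht : 0 ≤ t) :
    ∃ (B : BlockSystem) (w : B.Weight G), (∀ n v, 0 ≤ w.A n v) ∧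
      (∀ n, ∃ (n' : ℕ) (c : B.V n' → ℕ), g n = ∑ v, c v • w.A n' v) ∧ B.flow.entropy = t := by
  let τ : ℕ → ℝ := fun n => t + 1 / ((n : ℝ) + 1)
  have htτ : ∀ n, t < τ n := fun n => lt_add_of_pos_right _ Nat.one_div_pos_of_nat
  have hτ0 : ∀ n, 0 ≤ τ n := fun n => ht.trans (htτ n).le
  have hτ : ∀ n, τ (n + 1) < τ n := by
    intro n
    have := Nat.one_div_lt_one_div (α := ℝ) (Nat.lt_succ_self n)
    simp only [τ]
    push_cast at this ⊢
    linarith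
  have hthr : ∀ n q l : ℕ, ∃ ε > 0, ∃ m₀ : ℕ, 0 < q → ε ≤ q * (τ n - τ (n + 1)) ∧
      ∀ m ≥ m₀, ∀ l' : ℕ, (l' : ℝ) ≤ Real.exp (ε * m) →
      l' * (⌈Real.exp (τ (n + 1) * (q * m : ℕ))⌉₊ + 2) *
        (m + 1) ^ (l * (⌈Real.exp (τ n * q)⌉₊ + 2)) ≤
        (⌈Real.exp (τ n * q)⌉₊ + 1) ^ (m - l * (⌈Real.exp (τ n * q)⌉₊ + 2) - 1) := by
    intro n q l
    rcases q.eq_zero_or_pos with rfl | hq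
    · exact ⟨1, one_pos, 0, fun h => absurd h (lt_irrefl _)⟩
    · obtain ⟨ε, hε, hε', m₀, h⟩ := exists_word_threshold q l hq (hτ0 (n + 1)) (hτ n)
      exact ⟨ε, hε, m₀, fun _ => ⟨hε', h⟩⟩
  choose ε hε m₀ hthr using hthr
  obtain ⟨S, m, y, hS0, hS⟩ := hG.exists_stages hs hu hdiv g hg
    (fun n q _ => ⌈Real.exp (τ n * q)⌉₊ + 3) m₀ ε hε
  have hthr := fun n => hthr n (S n).q (Fintype.card (S n).ι) (S n).q_pos
  obtain ⟨B, w, hq, hV, hA, hgen⟩ := exists_weight_of_stages hu.ne' S m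
    (fun n => ⌈Real.exp (τ n * (S n).q)⌉₊) _ _ g y hS0 hS fun n => by
      have := (hthr n).2 (m n) (hS n).le _ (hS n).card_le
      rwa [← (hS n).q_eq] at this
  have hlow : ∀ n, Real.exp (t * B.q n) ≤ Fintype.card (B.V n) := by
    intro n
    have := (S n).nonempty hu.ne'
    have h1 : 1 ≤ Fintype.card (S n).ι := Fintype.card_pos
    rw [hV, hq]
    calc Real.exp (t * (S n).q) ≤ Real.exp (τ n * (S n).q) := by gcongr; exact (htτ n).le
      _ ≤ ⌈Real.exp (τ n * (S n).q)⌉₊ := Nat.le_ceil _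
      _ ≤ _ := by
        norm_cast
        nlinarith
  refine ⟨B, w, hA, hgen, le_antisymm (BlockSystem.entropy_le ?_) (BlockSystem.le_entropy hlow)⟩
  rw [← tendsto_add_atTop_iff_nat 1]
  have hinv : Tendsto (fun n : ℕ => 1 / ((n : ℝ) + 1)) atTop (𝓝 0) :=
    tendsto_one_div_add_atTop_nhds_zero_nat
  have hup : Tendsto (fun n : ℕ => τ n + Real.log 4 * (1 / ((n : ℝ) + 1))) atTop (𝓝 t) := by
    simpa [τ] using ((tendsto_const_nhds (x := t)).add hinv).add (hinv.const_mul (Real.log 4))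
  refine tendsto_of_tendsto_of_tendsto_of_le_of_le tendsto_const_nhds hup (fun n => ?_)
    fun n => ?_
  · have hq0 : (0 : ℝ) < B.q (n + 1) := by exact_mod_cast B.q_pos (n + 1)
    rw [le_div_iff₀ hq0]
    exact (Real.le_log_iff_exp_le ((Real.exp_pos _).trans_le (hlow _))).2 (hlow _)
  · have hq0 : (0 : ℝ) < B.q (n + 1) := by exact_mod_cast B.q_pos (n + 1)
    have hnq : (n : ℝ) + 1 ≤ B.q (n + 1) := by exact_mod_cast (B.lt_q (n + 1)).le
    have hqm : (B.q (n + 1) : ℝ) = (S n).q * m n := by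
      rw [hq, (hS n).q_eq, Nat.cast_mul]
    have hlog : Real.log (Fintype.card (B.V (n + 1))) ≤ Real.log 4 + τ n * B.q (n + 1) := by
      rw [Real.log_le_iff_le_exp ((Real.exp_pos _).trans_le (hlow _)), hV, ← hq]
      push_cast
      calc _ ≤ Real.exp (ε n (S n).q (Fintype.card (S n).ι) * m n) *
            Real.exp (Real.log 4 + τ (n + 1) * B.q (n + 1)) := by
            gcongr
            · exact (hS n).card_le
            · exact ceil_exp_add_two_le (mul_nonneg (hτ0 _) hq0.le)
        _ ≤ _ := by
          rw [← Real.exp_add]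
          refine Real.exp_le_exp.2 ?_
          have := mul_le_mul_of_nonneg_right (hthr n).1 (Nat.cast_nonneg (α := ℝ) (m n))
          rw [hqm]
          linarith
    calc _ ≤ (Real.log 4 + τ n * B.q (n + 1)) / B.q (n + 1) := by gcongr
      _ = τ n + Real.log 4 * (1 / B.q (n + 1)) := by field_simp; ring
      _ ≤ _ := by gcongr

end Realization

section Cone

open Finset

variable {G : Type} [AddCommGroup G] {P : Set G}

/-- The partial order with positive cone `P`. -/
abbrev IsSimpleDimensionGroup.partialOrder (hG : IsSimpleDimensionGroup G P) : PartialOrder G where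
  le a b := b - a ∈ P
  le_refl a := by rw [sub_self]; exact hG.zero_mem
  le_trans a b c h h' := by have := hG.add_mem _ _ h h'; rwa [add_comm, sub_add_sub_cancel] at this
  le_antisymm a b h h' := (sub_eq_zero.1 (hG.pos_neg_eq_zero _ h (by rwa [neg_sub]))).symm

lemma IsSimpleDimensionGroup.torsionFree (hG : IsSimpleDimensionGroup G P) (n : ℤ) (a : G)
    (hn : n ≠ 0) (h : n • a = 0) : a = 0 := by
  wlog hpos : 1 ≤ n generalizing n
  · exact this (-n) (by omega) (by rw [neg_smul, h, neg_zero]) (by omega)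
  · exact hG.pos_neg_eq_zero a (hG.unperforated n a hpos (h ▸ hG.zero_mem))
      (hG.unperforated n (-a) hpos (by rw [smul_neg, h, neg_zero]; exact hG.zero_mem))

lemma IsSimpleDimensionGroup.isDimensionOrder (hG : IsSimpleDimensionGroup G P) :
    letI := hG.partialOrder
    IsDimensionOrder G := by
  let _ := hG.partialOrder
  have hle : ∀ a b : G, a ≤ b ↔ b - a ∈ P := fun _ _ => Iff.rfl
  refine ⟨fun a b c ha hb hc habc => ?_, fun n a hn h => ?_⟩
  · rw [hle] at ha hb hc habc
    obtain ⟨d, h1, h2, h3, h4⟩ := hG.riesz 0 (a - c) a b ha hb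
      (by rw [sub_zero] at hc; rwa [sub_sub_cancel]) (by convert habc using 1; abel)
    refine ⟨d, a - d, h1, h4, ?_, ?_, by abel⟩
    · rwa [hle, sub_zero]
    · rw [hle]
      convert h2 using 1
      abel
  · rw [hle, sub_zero] at h ⊢
    exact hG.unperforated n a (by omega) (by rwa [natCast_zsmul])

end Cone

/-- every countable simple dimension group `(G, G⁺)` containing a
noncyclic rank-one subgroup `H` with `H ∩ G⁺ ≠ {0}` is realized as
`(K⁰(X,T), K⁰(X,T)⁺)` of a Toeplitz flow `(X, T)` with prescribed entropy `t`. -/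
theorem simple_dimension_group_with_rank_one_subgroup_realized
    (G : Type) [AddCommGroup G] (P : Set G)
    (hG : IsSimpleDimensionGroup G P)
    (H : AddSubgroup G)
    (hHnoncyclic : ¬ ∃ g ∈ H, ∀ x ∈ H, ∃ n : ℤ, x = n • g)
    (hHrankone : ∀ a ∈ H, ∀ b ∈ H, ∃ m n : ℤ, ¬ (m = 0 ∧ n = 0) ∧ m • a = n • b)
    (hHP : (H : Set G) ∩ P ≠ {0})
    (t : ℝ) (ht : 0 ≤ t) :
    ∃ F : ToeplitzFlow, ∃ φ : C(F.X, ℤ) →+ G,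
      Function.Surjective φ ∧
      φ.ker = coboundaries F.T ∧
      ⇑φ '' {f : C(F.X, ℤ) | ∀ x : F.X, 0 ≤ f x} = P ∧
      F.entropy = (t : EReal) := by
  obtain ⟨u, huH, huP, hu⟩ : ∃ u ∈ H, u ∈ P ∧ u ≠ 0 := by
    by_contra! h
    refine hHP (Set.eq_singleton_iff_unique_mem.2 ⟨⟨H.zero_mem, hG.zero_mem⟩, ?_⟩)
    exact fun x hx => h x hx.1 hx.2
  let _ := hG.partialOrder
  have hle : ∀ a b : G, a ≤ b ↔ b - a ∈ P := fun _ _ => Iff.rfl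
  have h0 : ∀ a : G, 0 ≤ a ↔ a ∈ P := fun a => by rw [hle, sub_zero]
  have : IsOrderedAddMonoid G :=
    ⟨fun a b h c => by rw [hle] at h ⊢; rwa [add_sub_add_right_eq_sub],
      fun a b h c => by rw [hle] at h ⊢; rwa [add_sub_add_left_eq_sub]⟩
  have hs : ∀ a : G, 0 < a → ∀ b, ∃ n : ℕ, b ≤ n • a := by
    intro a ha b
    obtain ⟨n, hn, h⟩ := (hG.simple a ((h0 a).1 ha.le) ha.ne').2 b
    refine ⟨n.toNat, ?_⟩
    rwa [hle, ← natCast_zsmul, Int.toNat_of_nonneg (by omega)]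
  have := hG.countable
  have : Nonempty P := ⟨⟨0, hG.zero_mem⟩⟩
  obtain ⟨g, hg⟩ := exists_surjective_nat P
  obtain ⟨B, w, hA, hgen, hent⟩ := hG.isDimensionOrder.exists_weight hs
    (((h0 u).2 huP).lt_of_ne' hu)
    (exists_large_divisor hG.torsionFree H hHnoncyclic hHrankone huH hu)
    (fun n => (g n : G)) (fun n => (h0 _).2 (g n).2) ht
  have himage : w.hom '' {f | ∀ x, 0 ≤ f x} = P := by
    rw [w.hom_image_nonneg]
    ext x
    constructor
    · rintro ⟨n, c, rfl⟩
      exact (h0 _).1 (Finset.sum_nonneg fun v _ => nsmul_nonneg (hA n v) _)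
    · intro hx
      obtain ⟨n, hn⟩ := hg ⟨x, hx⟩
      obtain ⟨n', c, h⟩ := hgen n
      exact ⟨n', c, by rw [← h, hn]⟩
  refine ⟨B.flow, w.hom, fun x => ?_, w.ker_hom, himage, hent⟩
  obtain ⟨a, ha, b, hb, rfl⟩ := hG.directed x
  rw [← himage] at ha hb
  obtain ⟨f, -, rfl⟩ := ha
  obtain ⟨f', -, rfl⟩ := hb
  exact ⟨f - f', map_sub _ _ _⟩
end

section
/- Let (G, G⁺) be a torsion-free partially ordered abelian group that is unperforated (for all n ≥ 1 and a ∈ G, n·a ∈ G⁺ implies a ∈ G⁺), and let u ∈ G⁺ with u ≠ 0. Then there is a well-defined map Γ : ℚ(G,u) → ℚ satisfying Γ(g) = m/n whenever n·g = m·u with n ≥ 1 and m ∈ ℤ; Γ is an injective group homomorphism with Γ(u) = 1; and for every g ∈ ℚ(G,u), Γ(g) ≥ 0 if and only if g ∈ G⁺. In particular, ℚ(G,u) is order isomorphic to a subgroup of ℚ containing ℤ, by a map sending u to 1. -/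
/-- The rational subgroup `ℚ(G, u) = {g : ∃ n ≥ 1, m, n • g = m • u}`. -/
def rationalSubgroup (G : Type*) [AddCommGroup G] (u : G) : AddSubgroup G where
  carrier := {g : G | ∃ n : ℤ, 1 ≤ n ∧ ∃ m : ℤ, n • g = m • u}
  zero_mem' := ⟨1, le_refl 1, 0, by simp⟩
  add_mem' := by
    rintro a b ⟨n₁, hn₁, m₁, h₁⟩ ⟨n₂, hn₂, m₂, h₂⟩
    refine ⟨n₁ * n₂, by nlinarith, n₂ * m₁ + n₁ * m₂, ?_⟩
    have : (n₁ * n₂) • (a + b) = n₂ • (n₁ • a) + n₁ • (n₂ • b) := by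
      rw [smul_add, smul_smul, smul_smul, mul_comm n₂ n₁]
    rw [this, h₁, h₂, smul_smul, smul_smul, ← add_smul]
  neg_mem' := by
    rintro a ⟨n, hn, m, h⟩
    exact ⟨n, hn, -m, by rw [smul_neg, h, neg_smul]⟩

/-- If `u` has infinite order, the fraction `m / n` in `n • g = m • u` depends only on `g`. -/
theorem div_eq_div_of_zsmul_eq_zsmul {G : Type*} [AddCommGroup G] {u : G}
    (hu : ∀ k : ℤ, k • u = 0 → k = 0) {g : G} {n m n' m' : ℤ} (hn : 1 ≤ n) (hn' : 1 ≤ n')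
    (h : n • g = m • u) (h' : n' • g = m' • u) : (m : ℚ) / n = (m' : ℚ) / n' := by
  have key : (m * n' - m' * n) • u = 0 := by
    rw [sub_smul, mul_comm m, mul_comm m', mul_smul, mul_smul, ← h, ← h', smul_comm, sub_self]
  have hn0 : (n : ℚ) ≠ 0 := by exact_mod_cast (by omega : n ≠ 0)
  have hn0' : (n' : ℚ) ≠ 0 := by exact_mod_cast (by omega : n' ≠ 0)
  rw [div_eq_div_iff hn0 hn0']
  exact_mod_cast sub_eq_zero.mp (hu _ key)

/-- The homomorphism `ℚ(G, u) → ℚ` given by `g ↦ m / n` for `n • g = m • u`. -/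
theorem exists_rationalSubgroup_addMonoidHom {G : Type*} [AddCommGroup G] {u : G}
    (hu : ∀ k : ℤ, k • u = 0 → k = 0) :
    ∃ Γ : rationalSubgroup G u →+ ℚ, ∀ (g : rationalSubgroup G u) (n m : ℤ), 1 ≤ n →
      n • (g : G) = m • u → Γ g = (m : ℚ) / (n : ℚ) := by
  have hmem (g : rationalSubgroup G u) : ∃ n : ℤ, 1 ≤ n ∧ ∃ m : ℤ, n • (g : G) = m • u := g.2
  choose n hn m h using hmem
  refine ⟨AddMonoidHom.mk' (fun g => (m g : ℚ) / n g) fun a b => ?_, fun g n' m' hn' h' =>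
    div_eq_div_of_zsmul_eq_zsmul hu (hn g) hn' (h g) h'⟩
  have hab : (n a * n b) • ((a + b : rationalSubgroup G u) : G)
      = (m a * n b + n a * m b) • u := by
    rw [AddSubgroup.coe_add, smul_add, add_smul, mul_smul (n a) (m b), ← h b, mul_smul (n a),
      mul_smul (n a), mul_comm (m a), mul_smul (n b), ← h a, smul_comm (n b) (n a) (a : G)]
  have hn0 : (n a : ℚ) ≠ 0 := by exact_mod_cast (by have := hn a; omega : n a ≠ 0)
  have hn0' : (n b : ℚ) ≠ 0 := by exact_mod_cast (by have := hn b; omega : n b ≠ 0)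
  have hpos : 1 ≤ n a * n b := by nlinarith [hn a, hn b]
  rw [div_eq_div_of_zsmul_eq_zsmul hu (hn _) hpos (h _) hab, div_add_div _ _ hn0 hn0']
  push_cast
  rfl

/-- for a torsion-free unperforated partially ordered abelian group
`(G, P)` and a nonzero `u ∈ P`, the rational subgroup `ℚ(G,u)` embeds into `ℚ`
by an injective order-preserving homomorphism `Γ` with `Γ(g) = m / n` whenever
`n • g = m • u` (`n ≥ 1`), and `Γ(u) = 1`; its range contains `ℤ`. -/
theorem rationalSubgroup_embeds_in_rat
    (G : Type*) [AddCommGroup G] (P : Set G)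
    (hzero : (0 : G) ∈ P)
    (hadd : ∀ a b : G, a ∈ P → b ∈ P → a + b ∈ P)
    (hcone : ∀ a : G, a ∈ P → -a ∈ P → a = 0)
    (htf : ∀ (n : ℤ) (g : G), 1 ≤ n → n • g = 0 → g = 0)
    (hunperf : ∀ (n : ℤ) (a : G), 1 ≤ n → n • a ∈ P → a ∈ P)
    (u : G) (huP : u ∈ P) (hu0 : u ≠ 0) :
    ∃ Γ : rationalSubgroup G u →+ ℚ,
      (∀ (g : rationalSubgroup G u) (n m : ℤ), 1 ≤ n → n • (g : G) = m • u →
        Γ g = (m : ℚ) / (n : ℚ)) ∧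
      Function.Injective Γ ∧
      (∀ hu : u ∈ rationalSubgroup G u, Γ ⟨u, hu⟩ = 1) ∧
      (∀ g : rationalSubgroup G u, 0 ≤ Γ g ↔ (g : G) ∈ P) ∧
      (∀ k : ℤ, (k : ℚ) ∈ Set.range Γ) := by
  have hu (k : ℤ) (hk : k • u = 0) : k = 0 := by
    by_contra hne
    rcases lt_or_gt_of_ne hne with hlt | hgt
    · exact hu0 (htf (-k) u (by omega) (by rw [neg_smul, hk, neg_zero]))
    · exact hu0 (htf k u hgt hk)
  have hsmul (k : ℤ) (hk : 0 ≤ k) (a : G) (ha : a ∈ P) : k • a ∈ P := by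
    lift k to ℕ using hk
    rw [natCast_zsmul]
    induction k with
    | zero => simpa using hzero
    | succ k ih => simpa [succ_nsmul] using hadd _ _ ih ha
  obtain ⟨Γ, hΓ⟩ := exists_rationalSubgroup_addMonoidHom hu
  have hu_mem : u ∈ rationalSubgroup G u := ⟨1, le_rfl, 1, rfl⟩
  refine ⟨Γ, hΓ, ?_, fun hu' => by simpa using hΓ ⟨u, hu'⟩ 1 1 le_rfl rfl, fun g => ?_,
    fun k => ⟨k • ⟨u, hu_mem⟩, by simpa using hΓ (k • ⟨u, hu_mem⟩) 1 k le_rfl (by simp)⟩⟩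
  · rw [injective_iff_map_eq_zero]
    intro g hg
    obtain ⟨n, hn, m, h⟩ := g.2
    have hn0 : (n : ℚ) ≠ 0 := by exact_mod_cast (by omega : n ≠ 0)
    rw [hΓ g n m hn h, div_eq_zero_iff, or_iff_left hn0, Int.cast_eq_zero] at hg
    exact Subtype.ext (htf n g hn (by rw [h, hg, zero_smul]))
  · obtain ⟨n, hn, m, h⟩ := g.2
    have hn0 : (0 : ℚ) < n := by exact_mod_cast hn
    rw [hΓ g n m hn h, le_div_iff₀ hn0, zero_mul, Int.cast_nonneg_iff]
    refine ⟨fun hm => hunperf n g hn (h ▸ hsmul m hm u huP), fun hg => ?_⟩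
    by_contra! hm
    have hmP : m • u ∈ P := h ▸ hsmul n (by omega) g hg
    have hmP' : -(m • u) ∈ P := by
      rw [← neg_smul]
      exact hsmul (-m) (by omega) u huP
    exact hm.ne (hu m (hcone _ hmP hmP'))
end
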